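/- Let ℙ = ℙ₀ ⊔ ℙ₊ ⊔ ℙ₋ be a partition of the set of all primes into three sets each having a natural density, such that ℙ₀ is a regular set of primes of density 0 and the natural density of ℙ₋ is not zero. Let ψ : ℕ → ℝ be a multiplicative arithmetic function taking values in {0, 1, −1} such that for every prime p: ψ(p) = 0 if and only if p ∈ ℙ₀, ψ(p) = 1 if and only if p ∈ ℙ₊, and ψ(p) = −1 if and only if p ∈ ℙ₋. Then the set {n ∈ ℕ : ψ(n) ≠ 0} has a natural density d, and both sets {n ∈ ℕ : ψ(n) > 0} and {n ∈ ℕ : ψ(n) < 0} have natural density equal to d/2. -/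

import Mathlib

open Filter Topology

/-- `primeCount S x = #{p ∈ S : p ≤ x}`, the counting function of a set `S ⊆ ℕ`. -/
noncomputable def primeCount (S : Set ℕ) (x : ℝ) : ℕ := {p ∈ S | (p : ℝ) ≤ x}.ncard

/-- A set of primes `S` is *regular* (with constant `a`, its Dirichlet density) if
`P_S(z) = a·log(1/(z-1)) + g(z)` on `{Re z > 1}` where `g` is holomorphic on an open set
containing the closed half-plane `{Re z ≥ 1}`. -/
def RegularSet (S : Set ℕ) (a : ℝ) : Prop :=
  ∃ g : ℂ → ℂ,
    (∃ U : Set ℂ, IsOpen U ∧ {z : ℂ | 1 ≤ z.re} ⊆ U ∧ DifferentiableOn ℂ g U) ∧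
    ∀ z : ℂ, 1 < z.re →
      (∑' p : S, ((p : ℕ) : ℂ) ^ (-z)) = (a : ℂ) * Complex.log (1 / (z - 1)) + g z

section Tauberian

open MeasureTheory Set

/-- The Fejér kernel `2 (1 - cos x) / x ^ 2`. -/
noncomputable def fejerKernel (x : ℝ) : ℝ := 2 * (1 - Real.cos x) / x ^ 2

theorem fejerKernel_nonneg (x : ℝ) : 0 ≤ fejerKernel x := by
  have := Real.cos_le_one x
  unfold fejerKernel
  exact div_nonneg (by linarith) (by positivity)

theorem fejerKernel_le (x : ℝ) : fejerKernel x ≤ 5 * (1 + x ^ 2)⁻¹ := by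
  unfold fejerKernel
  rcases eq_or_ne x 0 with rfl | hx
  · simp
  have hx2 : 0 < x ^ 2 := by positivity
  have h1 := Real.neg_one_le_cos x
  have h2 := Real.one_sub_sq_div_two_le_cos (x := x)
  rw [← div_eq_mul_inv, div_le_div_iff₀ hx2 (by positivity)]
  rcases le_total (x ^ 2) 4 with h | h
  · nlinarith
  · nlinarith

theorem measurable_fejerKernel : Measurable fejerKernel := by
  unfold fejerKernel
  fun_prop

theorem integrable_fejerKernel : Integrable fejerKernel := by
  refine (integrable_inv_one_add_sq.const_mul 5).mono' measurable_fejerKernel.aestronglyMeasurable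
    (ae_of_all _ fun x => ?_)
  rw [Real.norm_of_nonneg (fejerKernel_nonneg x)]
  exact fejerKernel_le x

theorem integral_fejerKernel_pos : 0 < ∫ x, fejerKernel x := by
  rw [integral_pos_iff_support_of_nonneg fejerKernel_nonneg integrable_fejerKernel]
  refine lt_of_lt_of_le ?_ (measure_mono (s := Ioo 1 2) fun x hx => ?_)
  · simp
  · have hx1 : 1 < x := hx.1
    have : Real.cos x < 1 := by
      rw [← Real.cos_zero]
      exact Real.cos_lt_cos_of_nonneg_of_le_pi le_rfl (by linarith [hx.2, Real.pi_gt_three])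
        (by linarith)
    have h : 0 < fejerKernel x := div_pos (by linarith) (by positivity)
    exact h.ne'

theorem integral_one_sub_mul_cexp {a : ℂ} (ha : a ≠ 0) :
    ∫ t in (0 : ℝ)..1, (1 - (t : ℂ)) * Complex.exp (a * t) = (Complex.exp a - 1 - a) / a ^ 2 := by
  have hd : ∀ t ∈ uIcc (0 : ℝ) 1, HasDerivAt
      (fun t : ℝ => ((1 - (t : ℂ)) / a + 1 / a ^ 2) * Complex.exp (a * t))
      ((1 - (t : ℂ)) * Complex.exp (a * t)) t := by
    intro t _
    have h1 : HasDerivAt (fun t : ℝ => (t : ℂ)) 1 t := Complex.ofRealCLM.hasDerivAt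
    have h2 := (((h1.const_sub 1).div_const a).add_const (1 / a ^ 2)).mul
      ((h1.const_mul a).cexp)
    refine h2.congr_deriv ?_
    field_simp
    ring
  rw [intervalIntegral.integral_eq_sub_of_hasDerivAt hd
    (Continuous.intervalIntegrable (by fun_prop) _ _)]
  simp
  field_simp
  ring

theorem integral_one_sub_abs_mul_cexp {x : ℝ} (hx : x ≠ 0) :
    ∫ t in (-1 : ℝ)..1, ((1 - |t| : ℝ) : ℂ) * Complex.exp (Complex.I * x * t) =
      fejerKernel x := by
  have hc : Continuous fun t : ℝ => ((1 - |t| : ℝ) : ℂ) * Complex.exp (Complex.I * x * t) := by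
    fun_prop
  have ha : Complex.I * x ≠ 0 := by simp [hx]
  rw [← intervalIntegral.integral_add_adjacent_intervals (b := 0) (hc.intervalIntegrable _ _)
    (hc.intervalIntegrable _ _)]
  have h1 : ∫ t in (0 : ℝ)..1, ((1 - |t| : ℝ) : ℂ) * Complex.exp (Complex.I * x * t) =
      (Complex.exp (Complex.I * x) - 1 - Complex.I * x) / (Complex.I * x) ^ 2 := by
    rw [← integral_one_sub_mul_cexp ha]
    refine intervalIntegral.integral_congr fun t ht => ?_
    rw [uIcc_of_le zero_le_one] at ht
    simp [abs_of_nonneg ht.1]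
  have h2 : ∫ t in (-1 : ℝ)..0, ((1 - |t| : ℝ) : ℂ) * Complex.exp (Complex.I * x * t) =
      (Complex.exp (-(Complex.I * x)) - 1 + Complex.I * x) / (Complex.I * x) ^ 2 := by
    have := integral_one_sub_mul_cexp (neg_ne_zero.2 ha)
    rw [neg_sq, sub_neg_eq_add] at this
    rw [← this, show (0 : ℝ) = -0 by simp, ← intervalIntegral.integral_comp_neg]
    simp only [neg_zero]
    refine intervalIntegral.integral_congr fun t ht => ?_
    rw [uIcc_of_le zero_le_one] at ht
    simp [abs_of_nonneg ht.1]
  rw [h1, h2, fejerKernel]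
  have hxc : (x : ℂ) ≠ 0 := by exact_mod_cast hx
  push_cast
  rw [Complex.cos, mul_pow, Complex.I_sq, neg_mul,
    mul_comm (x : ℂ) Complex.I]
  field_simp
  ring


theorem integral_mul_exp_mul_fejerKernel {r : ℝ → ℝ} {C : ℝ} (hm : Measurable r)
    (hC : ∀ u, |r u| ≤ C) {F : ℂ → ℂ}
    (hFr : ∀ s : ℂ, 0 < s.re → ∫ u in Ioi (0 : ℝ), (r u : ℂ) * Complex.exp (-s * u) = F s)
    {l : ℝ} (hl : 0 < l) {ε : ℝ} (hε : 0 < ε) (v : ℝ) :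
    ∫ u in Ioi (0 : ℝ), ((r u * Real.exp (-ε * u) * fejerKernel (l * (v - u)) : ℝ) : ℂ) =
      ∫ t in (-1 : ℝ)..1, ((1 - |t| : ℝ) : ℂ) * Complex.exp (Complex.I * (l * v : ℝ) * t) *
        F (ε + Complex.I * (l * t : ℝ)) := by
  rw [intervalIntegral.integral_of_le (by norm_num)]
  let f : ℝ → ℝ → ℂ := fun u t => (r u : ℂ) * Complex.exp (-(ε : ℂ) * u) *
    (((1 - |t| : ℝ) : ℂ) * Complex.exp (Complex.I * (l * (v - u) : ℝ) * t))
  have hint : Integrable (Function.uncurry f)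
      ((volume.restrict (Ioi (0 : ℝ))).prod (volume.restrict (Ioc (-1 : ℝ) 1))) := by
    have h1 : Integrable (fun u : ℝ => C * Real.exp (-ε * u)) (volume.restrict (Ioi (0 : ℝ))) :=
      (integrableOn_exp_mul_Ioi (by linarith) 0).const_mul C
    have h2 : Integrable (fun t : ℝ => (1 : ℝ)) (volume.restrict (Ioc (-1 : ℝ) 1)) := by
      simp
    refine (h1.mul_prod h2).mono' ?_ ?_
    · refine Measurable.aestronglyMeasurable ?_
      simp only [f, Function.uncurry_def]
      fun_prop
    · rw [Measure.prod_restrict]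
      refine (ae_restrict_iff' (measurableSet_Ioi.prod measurableSet_Ioc)).2 (ae_of_all _ ?_)
      rintro ⟨u, t⟩ ⟨_, ht⟩
      have ht1 : |(1 - |t|)| ≤ 1 := by
        have : |t| ≤ 1 := abs_le.2 ⟨ht.1.le, ht.2⟩
        rw [abs_le]
        constructor <;> linarith [abs_nonneg t]
      simp only [Function.uncurry_apply_pair, f, norm_mul, Complex.norm_real, Real.norm_eq_abs,
        Complex.norm_exp]
      simp
      have := hC u
      have hp := (Real.exp_pos (-(ε * u))).le
      nlinarith [mul_le_mul this ht1 (abs_nonneg _) ((abs_nonneg _).trans this)]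
  have hswap := integral_integral_swap hint
  calc _ = ∫ u in Ioi (0 : ℝ), ∫ t in Ioc (-1 : ℝ) 1, f u t := by
        refine integral_congr_ae ?_
        have hne : ∀ᵐ u ∂(volume.restrict (Ioi (0 : ℝ))), u ≠ v :=
          ae_restrict_of_ae (by simp [ae_iff])
        filter_upwards [hne] with u hu
        have hx : l * (v - u) ≠ 0 := mul_ne_zero hl.ne' (sub_ne_zero.2 hu.symm)
        simp only [f]
        rw [integral_const_mul, ← intervalIntegral.integral_of_le (by norm_num),
          integral_one_sub_abs_mul_cexp hx]
        push_cast
        rfl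
    _ = _ := by
        rw [hswap]
        refine integral_congr_ae (ae_of_all _ fun t => ?_)
        simp only [f]
        rw [← hFr _ (by simpa using hε), ← integral_const_mul]
        refine integral_congr_ae (ae_of_all _ fun u => ?_)
        simp only
        have : Complex.exp (Complex.I * (l * (v - u) : ℝ) * t) * Complex.exp (-(ε : ℂ) * u) =
            Complex.exp (Complex.I * (l * v : ℝ) * t) *
              Complex.exp (-(ε + Complex.I * (l * t : ℝ)) * u) := by
          rw [← Complex.exp_add, ← Complex.exp_add]
          congr 1
          push_cast
          ring
        linear_combination ((r u : ℂ) * ((1 - |t| : ℝ) : ℂ)) * this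

theorem integral_mul_fejerKernel {r : ℝ → ℝ} {C : ℝ} (hm : Measurable r)
    (hC : ∀ u, |r u| ≤ C) {F : ℂ → ℂ} (hF : ContinuousOn F {s | 0 ≤ s.re})
    (hFr : ∀ s : ℂ, 0 < s.re → ∫ u in Ioi (0 : ℝ), (r u : ℂ) * Complex.exp (-s * u) = F s)
    {l : ℝ} (hl : 0 < l) (v : ℝ) :
    ∫ u in Ioi (0 : ℝ), ((r u * fejerKernel (l * (v - u)) : ℝ) : ℂ) =
      ∫ t in (-1 : ℝ)..1, ((1 - |t| : ℝ) : ℂ) * Complex.exp (Complex.I * (l * v : ℝ) * t) *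
        F (Complex.I * (l * t : ℝ)) := by
  have hC0 : 0 ≤ C := (abs_nonneg _).trans (hC 0)
  have hK : Integrable (fun u => fejerKernel (l * (v - u))) :=
    (integrable_fejerKernel.comp_mul_left' hl.ne').comp_sub_left v
  have hL : Tendsto (fun ε : ℝ => ∫ u in Ioi (0 : ℝ),
      ((r u * Real.exp (-ε * u) * fejerKernel (l * (v - u)) : ℝ) : ℂ)) (𝓝[>] 0)
      (𝓝 (∫ u in Ioi (0 : ℝ), ((r u * fejerKernel (l * (v - u)) : ℝ) : ℂ))) := by
    refine tendsto_integral_filter_of_dominated_convergence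
      (fun u => C * fejerKernel (l * (v - u))) ?_ ?_ (hK.const_mul C).integrableOn ?_
    · refine Eventually.of_forall fun ε => Measurable.aestronglyMeasurable ?_
      have := measurable_fejerKernel
      fun_prop
    · filter_upwards [self_mem_nhdsWithin] with ε hε
      refine (ae_restrict_iff' measurableSet_Ioi).2 (ae_of_all _ fun u hu => ?_)
      rw [Complex.norm_real, norm_mul, norm_mul, Real.norm_of_nonneg (fejerKernel_nonneg _),
        Real.norm_of_nonneg (Real.exp_pos _).le]
      refine mul_le_mul_of_nonneg_right ?_ (fejerKernel_nonneg _)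
      have : Real.exp (-ε * u) ≤ 1 := by
        rw [Real.exp_le_one_iff]
        have := mul_pos (show 0 < ε from hε) (show 0 < u from hu)
        linarith
      calc _ ≤ C * 1 := mul_le_mul (hC u) this (Real.exp_pos _).le hC0
        _ = C := mul_one C
    · refine ae_of_all _ fun u => ?_
      have : Continuous fun ε : ℝ =>
        ((r u * Real.exp (-ε * u) * fejerKernel (l * (v - u)) : ℝ) : ℂ) := by fun_prop
      simpa using (this.tendsto 0).mono_left nhdsWithin_le_nhds
  have hcomp : IsCompact (Icc (0 : ℝ) 1 ×ˢ Icc (-1 : ℝ) 1) := isCompact_Icc.prod isCompact_Icc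
  have hcont : ContinuousOn (fun p : ℝ × ℝ => F (p.1 + Complex.I * (l * p.2 : ℝ)))
      (Icc (0 : ℝ) 1 ×ˢ Icc (-1 : ℝ) 1) := by
    refine hF.comp (by fun_prop) fun p hp => ?_
    simpa using hp.1.1
  obtain ⟨D, hD⟩ := hcomp.exists_bound_of_continuousOn hcont
  have hR : Tendsto (fun ε : ℝ => ∫ t in (-1 : ℝ)..1, ((1 - |t| : ℝ) : ℂ) *
      Complex.exp (Complex.I * (l * v : ℝ) * t) * F (ε + Complex.I * (l * t : ℝ))) (𝓝[>] 0)
      (𝓝 (∫ t in (-1 : ℝ)..1, ((1 - |t| : ℝ) : ℂ) * Complex.exp (Complex.I * (l * v : ℝ) * t) *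
        F (Complex.I * (l * t : ℝ)))) := by
    have hI : ∀ᶠ ε : ℝ in 𝓝[>] 0, ε ∈ Icc (0 : ℝ) 1 := by
      filter_upwards [Ioo_mem_nhdsGT (zero_lt_one (α := ℝ))] with ε hε
      exact ⟨hε.1.le, hε.2.le⟩
    refine intervalIntegral.tendsto_integral_filter_of_dominated_convergence
      (fun _ => D) ?_ ?_ (by simp) ?_
    · filter_upwards [hI] with ε hε
      refine ContinuousOn.aestronglyMeasurable ?_ measurableSet_uIoc
      refine ContinuousOn.mul (by fun_prop) ?_
      refine hF.comp (by fun_prop) fun t _ => ?_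
      simpa using hε.1
    · filter_upwards [hI] with ε hε
      refine ae_of_all _ fun t ht => ?_
      rw [uIoc_of_le (by norm_num)] at ht
      have ht1 : |t| ≤ 1 := abs_le.2 ⟨ht.1.le, ht.2⟩
      have h1 : ‖((1 - |t| : ℝ) : ℂ)‖ ≤ 1 := by
        rw [Complex.norm_real, Real.norm_eq_abs, abs_le]
        constructor <;> linarith [abs_nonneg t]
      have h2 : ‖Complex.exp (Complex.I * (l * v : ℝ) * t)‖ = 1 := by
        rw [Complex.norm_exp]
        simp
      have h3 := hD (ε, t) ⟨hε, ht.1.le, ht.2⟩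
      rw [norm_mul, norm_mul, h2, mul_one]
      calc _ ≤ 1 * D := mul_le_mul h1 h3 (norm_nonneg _) zero_le_one
        _ = D := one_mul D
    · refine ae_of_all _ fun t ht => Tendsto.const_mul _ ?_
      have h1 : ContinuousWithinAt (fun ε : ℝ => F (ε + Complex.I * (l * t : ℝ))) (Ici 0) 0 := by
        have : ContinuousOn (fun ε : ℝ => F (ε + Complex.I * (l * t : ℝ))) (Ici 0) := by
          refine hF.comp (by fun_prop) fun ε hε => ?_
          simpa using hε
        exact this 0 self_mem_Ici
      have h2 := h1.tendsto.mono_left (nhdsWithin_mono 0 (Ioi_subset_Ici_self (a := (0 : ℝ))))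
      simpa using h2
  refine tendsto_nhds_unique hL (hR.congr' ?_)
  filter_upwards [self_mem_nhdsWithin] with ε hε
  exact (integral_mul_exp_mul_fejerKernel hm hC hFr hl hε v).symm

theorem tendsto_integral_mul_fejerKernel {r : ℝ → ℝ} {C : ℝ} (hm : Measurable r)
    (hC : ∀ u, |r u| ≤ C) (h0 : ∀ u < 0, r u = 0) {F : ℂ → ℂ}
    (hF : ContinuousOn F {s | 0 ≤ s.re})
    (hFr : ∀ s : ℂ, 0 < s.re → ∫ u in Ioi (0 : ℝ), (r u : ℂ) * Complex.exp (-s * u) = F s)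
    {l : ℝ} (hl : 0 < l) :
    Tendsto (fun v => ∫ y, r (v - y / l) * fejerKernel y) atTop (𝓝 0) := by
  have hRL := (Real.tendsto_integral_exp_smul_cocompact
    ((Ioc (-1 : ℝ) 1).indicator fun t => ((1 - |t| : ℝ) : ℂ) * F (Complex.I * (l * t : ℝ)))).comp
    ((tendsto_neg_atTop_atBot.comp (tendsto_id.const_mul_atTop
      (show 0 < l / (2 * Real.pi) by positivity))).mono_right atBot_le_cocompact)
  have hRe := (Complex.continuous_re.tendsto _).comp hRL |>.const_mul l
  rw [Complex.zero_re, mul_zero] at hRe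
  refine hRe.congr fun v => ?_
  have key := integral_mul_fejerKernel hm hC hF hFr hl v
  rw [integral_complex_ofReal, intervalIntegral.integral_of_le (by norm_num)] at key
  have hleft : ∫ y, r (v - y / l) * fejerKernel y =
      l * ∫ u in Ioi (0 : ℝ), r u * fejerKernel (l * (v - u)) := by
    rw [setIntegral_eq_integral_of_ae_compl_eq_zero]
    · have h1 := integral_sub_left_eq_self (fun u => r u * fejerKernel (l * (v - u))) volume v
      have h2 := Measure.integral_comp_div (fun y => r (v - y) * fejerKernel (l * y)) l
      rw [← h1]
      simp only [sub_sub_cancel]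
      rw [abs_of_pos hl, smul_eq_mul] at h2
      rw [← h2]
      congr 1
      ext y
      rw [mul_div_cancel₀ _ hl.ne']
    · have hne : ∀ᵐ u : ℝ, u ≠ 0 := by simp [ae_iff]
      filter_upwards [hne] with u hu hu'
      rw [h0 u (lt_of_le_of_ne (not_lt.1 hu') hu), zero_mul]
  rw [hleft]
  simp only [Function.comp_apply]
  congr 1
  rw [← Complex.ofReal_re (∫ u in Ioi (0 : ℝ), r u * fejerKernel (l * (v - u))), key,
    ← integral_indicator measurableSet_Ioc]
  congr 2
  ext t
  by_cases ht : t ∈ Ioc (-1 : ℝ) 1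
  · rw [indicator_of_mem ht, indicator_of_mem ht, Circle.smul_def, Real.fourierChar_apply,
      smul_eq_mul]
    have : Complex.exp (((2 * Real.pi * -(t * -(l / (2 * Real.pi) * id v)) : ℝ) : ℂ) * Complex.I) =
        Complex.exp (Complex.I * (l * v : ℝ) * t) := by
      congr 1
      have : 2 * Real.pi * -(t * -(l / (2 * Real.pi) * id v)) = l * v * t := by
        simp only [id]
        field_simp
      rw [this]
      push_cast
      ring
    rw [this]
    ring
  · rw [indicator_of_notMem ht, indicator_of_notMem ht, smul_zero]

theorem exists_lt_integral_of_le {C δ : ℝ} (hδ : 0 < δ) :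
    ∃ R > 0, ∀ f : ℝ → ℝ, Measurable f → (∀ y, |f y| ≤ C) → (∀ y, |y| ≤ R → δ ≤ f y) →
      δ / 2 * ∫ y, fejerKernel y ≤ ∫ y, f y * fejerKernel y := by
  have hI := integral_fejerKernel_pos
  have hlim := (intervalIntegral_tendsto_integral integrable_fejerKernel tendsto_neg_atTop_atBot
    tendsto_id).const_mul (C + δ)
  have hlt : C * (∫ y, fejerKernel y) + δ / 2 * (∫ y, fejerKernel y) <
      (C + δ) * ∫ y, fejerKernel y := by nlinarith
  obtain ⟨R, hR, hR0⟩ := ((hlim.eventually_const_lt hlt).and (eventually_gt_atTop 0)).exists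
  refine ⟨R, hR0, fun f hfm hfC hf => ?_⟩
  rw [intervalIntegral.integral_of_le (by simp only [id]; linarith)] at hR
  simp only [id] at hR
  have hint : Integrable (fun y => f y * fejerKernel y) :=
    integrable_fejerKernel.bdd_mul hfm.aestronglyMeasurable (ae_of_all _ hfC)
  have hle : ∫ y, ((Ioc (-R) R).indicator (fun y => (C + δ) * fejerKernel y) y -
      C * fejerKernel y) ≤ ∫ y, f y * fejerKernel y := by
    refine integral_mono (((integrable_fejerKernel.const_mul _).indicator measurableSet_Ioc).sub
      (integrable_fejerKernel.const_mul _)) hint fun y => ?_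
    have hK := fejerKernel_nonneg y
    by_cases hy : y ∈ Ioc (-R) R
    · have := hf y (abs_le.2 ⟨hy.1.le, hy.2⟩)
      simp only [indicator_of_mem hy]
      nlinarith
    · have := (abs_le.1 (hfC y)).1
      simp only [indicator_of_notMem hy]
      nlinarith
  rw [integral_sub ((integrable_fejerKernel.const_mul _).indicator measurableSet_Ioc)
    (integrable_fejerKernel.const_mul _), integral_indicator measurableSet_Ioc,
    integral_const_mul, integral_const_mul] at hle
  linarith

/-- A Tauberian theorem of Wiener–Ikehara type, in additive notation. -/
theorem tendsto_zero_of_laplace_continuousOn {r : ℝ → ℝ} {C : ℝ} (hm : Measurable r)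
    (hC : ∀ u, |r u| ≤ C) (h0 : ∀ u < 0, r u = 0)
    (hmono : ∀ u w, 0 ≤ u → u ≤ w → 1 + r u ≤ Real.exp (w - u) * (1 + r w)) {F : ℂ → ℂ}
    (hr1 : ∀ u, -1 ≤ r u)
    (hF : ContinuousOn F {s | 0 ≤ s.re})
    (hFr : ∀ s : ℂ, 0 < s.re → ∫ u in Ioi (0 : ℝ), (r u : ℂ) * Complex.exp (-s * u) = F s) :
    Tendsto r atTop (𝓝 0) := by
  rw [Metric.tendsto_nhds]
  intro δ' hδ'
  obtain ⟨δ, hδ, hδ1, hδδ'⟩ : ∃ δ > 0, δ ≤ 1 ∧ δ ≤ δ' :=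
    ⟨min δ' 1, by positivity, min_le_right _ _, min_le_left _ _⟩
  obtain ⟨R, hR, hRf⟩ := exists_lt_integral_of_le (C := C) (show 0 < δ / 4 by positivity)
  have hI := integral_fejerKernel_pos
  set η := Real.log (1 + δ / 2) / 2 with hη
  have hη0 : 0 < η := div_pos (Real.log_pos (by linarith)) two_pos
  have hexp : Real.exp (2 * η) = 1 + δ / 2 := by
    rw [hη, mul_div_cancel₀ _ two_ne_zero, Real.exp_log (by linarith)]
  have hl : 0 < R / η := by positivity
  have hlim := tendsto_integral_mul_fejerKernel hm hC h0 hF hFr hl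
  have hy : ∀ y, |y| ≤ R → |y / (R / η)| ≤ η := by
    intro y hy
    rw [abs_div, abs_of_pos hl, div_le_iff₀ hl, mul_div_cancel₀ _ hη0.ne']
    exact hy
  have hc : 0 < δ / 4 / 2 * ∫ y, fejerKernel y := by positivity
  have e1 := (tendsto_atTop_add_const_right _ η tendsto_id).eventually
    (hlim.eventually_lt_const hc)
  have e2 := (tendsto_atTop_add_const_right _ (-η) tendsto_id).eventually
    (hlim.eventually_const_lt (neg_lt_zero.2 hc))
  filter_upwards [e1, e2, eventually_ge_atTop (2 * η)] with v hv1 hv2 hv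
  simp only [id] at hv1 hv2
  rw [Real.dist_eq, sub_zero]
  refine lt_of_lt_of_le (abs_lt.2 ⟨?_, ?_⟩) hδδ'
  · by_contra! hcon
    have := hRf (fun y => -r (v + -η - y / (R / η))) (by fun_prop) (fun y => by simpa using hC _)
      fun y hy' => by
        have h1 := abs_le.1 (hy y hy')
        have h2 := hmono (v + -η - y / (R / η)) v (by linarith) (by linarith)
        have h3 : Real.exp (v - (v + -η - y / (R / η))) ≤ 1 + δ / 2 := by
          rw [← hexp]
          exact Real.exp_le_exp.2 (by linarith)
        have h4 := hr1 v
        nlinarith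
    simp only [neg_mul] at this
    rw [integral_neg] at this
    linarith
  · by_contra! hcon
    have := hRf (fun y => r (v + η - y / (R / η))) (by fun_prop) (fun y => hC _)
      fun y hy' => by
        have h1 := abs_le.1 (hy y hy')
        have h2 := hmono v (v + η - y / (R / η)) (by linarith) (by linarith)
        have h3 : Real.exp (v + η - y / (R / η) - v) ≤ 1 + δ / 2 := by
          rw [← hexp]
          exact Real.exp_le_exp.2 (by linarith)
        have h4 := hr1 (v + η - y / (R / η))
        nlinarith
    linarith

end Tauberian

section PrimeNumberTheorem

open MeasureTheory Set ArithmeticFunction.vonMangoldt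

theorem LSeries_vonMangoldt_eq_mul_integral {s : ℂ} (hs : 1 < s.re) :
    LSeries (fun n => (ArithmeticFunction.vonMangoldt n : ℂ)) s =
      s * ∫ u in Ioi (0 : ℝ), (Chebyshev.psi (Real.exp u) : ℂ) * Complex.exp (-s * u) := by
  have hsum : ∀ n : ℕ, ∑ k ∈ Finset.Icc 1 n, ArithmeticFunction.vonMangoldt k =
      Chebyshev.psi n := by
    intro n
    rw [Chebyshev.psi, Nat.floor_natCast]
    rfl
  rw [LSeries_eq_mul_integral_of_nonneg (fun n => ArithmeticFunction.vonMangoldt n) zero_le_one hs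
    ?_ fun _ => ArithmeticFunction.vonMangoldt_nonneg]
  · congr 1
    have himg : Ioi (1 : ℝ) = Real.exp '' Ioi 0 := by
      ext x
      constructor
      · intro hx
        exact ⟨Real.log x, Real.log_pos hx, Real.exp_log (zero_lt_one.trans hx)⟩
      · rintro ⟨u, hu, rfl⟩
        exact Real.one_lt_exp_iff.2 hu
    rw [himg, integral_image_eq_integral_abs_deriv_smul measurableSet_Ioi
      (fun u _ => (Real.hasDerivAt_exp u).hasDerivWithinAt) Real.exp_injective.injOn]
    refine integral_congr_ae (ae_of_all _ fun u => ?_)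
    simp only
    rw [abs_of_pos (Real.exp_pos u), ← Complex.ofReal_sum, hsum, ← Chebyshev.psi_eq_psi_coe_floor,
      Complex.real_smul, Complex.ofReal_exp, Complex.cpow_def_of_ne_zero (Complex.exp_ne_zero _),
      ← Complex.ofReal_exp, ← Complex.ofReal_log (Real.exp_pos u).le, Real.log_exp,
      Complex.ofReal_exp, mul_left_comm, ← Complex.exp_add]
    congr 2
    ring
  · refine Asymptotics.IsBigO.of_bound (Real.log 4 + 4) (Eventually.of_forall fun n => ?_)
    rw [hsum, Real.rpow_one, Real.norm_of_nonneg (Chebyshev.psi_nonneg _),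
      Real.norm_of_nonneg n.cast_nonneg]
    exact Chebyshev.psi_le_const_mul_self n.cast_nonneg

theorem tendsto_psi_exp_mul_exp_neg :
    Tendsto (fun u => Chebyshev.psi (Real.exp u) * Real.exp (-u)) atTop (𝓝 1) := by
  let r : ℝ → ℝ := fun u =>
    Chebyshev.psi (Real.exp u) * Real.exp (-u) - (Ici (0 : ℝ)).indicator (fun _ => 1) u
  have hmpsi : Measurable Chebyshev.psi := Chebyshev.psi_mono.measurable
  have hm : Measurable r :=
    ((hmpsi.comp Real.measurable_exp).mul (by fun_prop)).sub
      (measurable_const.indicator measurableSet_Ici)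
  have hnn : ∀ u, 0 ≤ Chebyshev.psi (Real.exp u) * Real.exp (-u) := fun u =>
    mul_nonneg (Chebyshev.psi_nonneg _) (Real.exp_pos _).le
  have hb : ∀ u, Chebyshev.psi (Real.exp u) * Real.exp (-u) ≤ Real.log 4 + 4 := fun u => by
    rw [Real.exp_neg, ← div_eq_mul_inv, div_le_iff₀ (Real.exp_pos u)]
    exact Chebyshev.psi_le_const_mul_self (Real.exp_pos u).le
  have hi0 : ∀ u : ℝ, 0 ≤ (Ici (0 : ℝ)).indicator (fun _ => (1 : ℝ)) u := fun u =>
    indicator_nonneg (fun _ _ => zero_le_one) u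
  have hi1 : ∀ u : ℝ, (Ici (0 : ℝ)).indicator (fun _ => (1 : ℝ)) u ≤ 1 := fun u =>
    indicator_le_self' (fun _ _ => zero_le_one) u
  have hlog4 : 0 < Real.log 4 := Real.log_pos (by norm_num)
  have hr : Tendsto r atTop (𝓝 0) := by
    refine tendsto_zero_of_laplace_continuousOn (C := Real.log 4 + 4) hm ?_ ?_ ?_ ?_
      (F := fun s => LFunctionResidueClassAux (1 : ZMod 1) (1 + s) / (1 + s) - 1 / (1 + s)) ?_ ?_
    · intro u
      rw [abs_le]
      constructor <;> simp only [r] <;> linarith [hnn u, hb u, hi0 u, hi1 u]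
    · intro u hu
      simp only [r]
      rw [indicator_of_notMem (by simpa using hu), Chebyshev.psi_eq_zero_of_le_one
        (Real.exp_le_one_iff.2 hu.le)]
      simp
    · intro u w hu huw
      simp only [r]
      rw [indicator_of_mem (show u ∈ Ici (0 : ℝ) from hu),
        indicator_of_mem (show w ∈ Ici (0 : ℝ) from hu.trans huw)]
      have h1 : Real.exp (w - u) * Real.exp (-w) = Real.exp (-u) := by
        rw [← Real.exp_add]
        congr 1
        ring
      have h2 := mul_le_mul_of_nonneg_right
        (Chebyshev.psi_mono (Real.exp_le_exp.2 huw)) (Real.exp_pos (-u)).le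
      calc _ ≤ Chebyshev.psi (Real.exp w) * Real.exp (-u) := by linarith
        _ = _ := by rw [← h1]; ring
    · intro u
      simp only [r]
      linarith [hnn u, hi1 u]
    · have h1 : ∀ s ∈ {s : ℂ | 0 ≤ s.re}, 1 + s ≠ 0 := by
        intro s hs h
        have := congrArg Complex.re h
        simp only [Complex.add_re, Complex.one_re, Complex.zero_re] at this
        linarith [show 0 ≤ s.re from hs]
      refine ContinuousOn.sub (ContinuousOn.div ?_ (by fun_prop) h1)
        (continuousOn_const.div (by fun_prop) h1)
      refine (continuousOn_LFunctionResidueClassAux (1 : ZMod 1)).comp (by fun_prop) fun s hs => ?_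
      simpa using hs
    · intro s hs
      have hs1 : 1 < (1 + s).re := by simpa using hs
      have hs0 : s ≠ 0 := by
        rintro rfl
        simp at hs
      have hs10 : 1 + s ≠ 0 := by
        intro h
        rw [h] at hs1
        simp at hs1
        linarith
      have hexp := integrableOn_exp_mul_complex_Ioi (a := -s) (by simpa using hs) 0
      have hA := eqOn_LFunctionResidueClassAux (a := (1 : ZMod 1)) isUnit_one hs1
      have hres : residueClass (1 : ZMod 1) = fun n : ℕ => ArithmeticFunction.vonMangoldt n := by
        funext n
        have hn : n ∈ {n : ℕ | (n : ZMod 1) = 1} := Subsingleton.elim (n : ZMod 1) 1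
        simp only [residueClass, indicator_of_mem hn]
      simp only [hres, Nat.totient_one, add_sub_cancel_left] at hA
      rw [LSeries_vonMangoldt_eq_mul_integral hs1] at hA
      have hsplit : ∫ u in Ioi (0 : ℝ), (r u : ℂ) * Complex.exp (-s * u) =
          (∫ u in Ioi (0 : ℝ), (Chebyshev.psi (Real.exp u) : ℂ) * Complex.exp (-(1 + s) * u)) -
            ∫ u in Ioi (0 : ℝ), Complex.exp (-s * u) := by
        have h1 : ∀ u : ℝ, (Chebyshev.psi (Real.exp u) : ℂ) * Complex.exp (-(1 + s) * u) =
            ((Chebyshev.psi (Real.exp u) * Real.exp (-u) : ℝ) : ℂ) * Complex.exp (-s * u) := by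
          intro u
          rw [Complex.ofReal_mul, Complex.ofReal_exp, mul_assoc, ← Complex.exp_add]
          congr 2
          push_cast
          ring
        simp only [h1]
        rw [← integral_sub _ hexp]
        · refine setIntegral_congr_fun measurableSet_Ioi fun u hu => ?_
          simp only [r]
          rw [indicator_of_mem (show u ∈ Ici (0 : ℝ) from (show 0 < u from hu).le)]
          push_cast
          ring
        · refine Integrable.bdd_mul (c := Real.log 4 + 4) hexp ?_ (ae_of_all _ fun u => ?_)
          · refine Measurable.aestronglyMeasurable ?_
            exact Complex.measurable_ofReal.comp
              ((hmpsi.comp Real.measurable_exp).mul (by fun_prop))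
          · rw [Complex.norm_real, Real.norm_of_nonneg (hnn u)]
            exact hb u
      rw [hsplit, integral_exp_mul_complex_Ioi (by simpa using hs), hA]
      simp
      field_simp
      ring
  have h1 := hr.add_const 1
  rw [zero_add] at h1
  refine h1.congr' ?_
  filter_upwards [eventually_ge_atTop 0] with u hu
  simp only [r]
  rw [indicator_of_mem (show u ∈ Ici (0 : ℝ) from hu)]
  ring

/-- The prime number theorem for Chebyshev's `ψ` function. -/
theorem tendsto_psi_div : Tendsto (fun x => Chebyshev.psi x / x) atTop (𝓝 1) := by
  refine (tendsto_psi_exp_mul_exp_neg.comp Real.tendsto_log_atTop).congr' ?_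
  filter_upwards [eventually_gt_atTop 0] with x hx
  simp only [Function.comp_apply]
  rw [Real.exp_neg, Real.exp_log hx, div_eq_mul_inv]

/-- The prime number theorem for Chebyshev's `θ` function. -/
theorem tendsto_theta_div : Tendsto (fun x => Chebyshev.theta x / x) atTop (𝓝 1) := by
  obtain ⟨C, hC⟩ := Chebyshev.psi_sub_theta_le_mul_sqrt
  have h0 : Tendsto (fun x => (Chebyshev.psi x - Chebyshev.theta x) / x) atTop (𝓝 0) := by
    have hs : Tendsto (fun x : ℝ => C * (√x)⁻¹) atTop (𝓝 0) := by
      simpa using (tendsto_inv_atTop_zero.comp Real.tendsto_sqrt_atTop).const_mul C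
    refine tendsto_of_tendsto_of_tendsto_of_le_of_le' tendsto_const_nhds hs ?_ ?_
    · filter_upwards [eventually_gt_atTop 0] with x hx
      exact div_nonneg (sub_nonneg.2 (Chebyshev.theta_le_psi x)) hx.le
    · filter_upwards [eventually_gt_atTop 0] with x hx
      rw [div_le_iff₀ hx, mul_assoc, inv_mul_eq_div, Real.div_sqrt]
      exact hC x
  simpa [sub_div] using tendsto_psi_div.sub h0

theorem tendsto_primeCounting_mul_log_sub_theta_div :
    Tendsto (fun x : ℝ => (Nat.primeCounting ⌊x⌋₊ * Real.log x - Chebyshev.theta x) / x)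
      atTop (𝓝 0) := by
  obtain ⟨C, hC⟩ := Chebyshev.primeCounting_sub_theta_div_log_isBigO.bound
  have hlog : Tendsto (fun x : ℝ => C * (Real.log x)⁻¹) atTop (𝓝 0) := by
    simpa using (tendsto_inv_atTop_zero.comp Real.tendsto_log_atTop).const_mul C
  refine squeeze_zero_norm' ?_ hlog
  filter_upwards [hC, eventually_gt_atTop 1] with x hx hx1
  have hl := Real.log_pos hx1
  have hx0 : 0 < x := by linarith
  rw [Real.norm_of_nonneg (show 0 ≤ x / Real.log x ^ 2 by positivity)] at hx
  have : (Nat.primeCounting ⌊x⌋₊ * Real.log x - Chebyshev.theta x) / x =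
      (Nat.primeCounting ⌊x⌋₊ - Chebyshev.theta x / Real.log x) * (Real.log x / x) := by
    field_simp
  rw [this, norm_mul, Real.norm_of_nonneg (show 0 ≤ Real.log x / x by positivity)]
  calc _ ≤ C * (x / Real.log x ^ 2) * (Real.log x / x) := by gcongr
    _ = _ := by field_simp

end PrimeNumberTheorem

section Recurrence

theorem inv_succ_le_log_succ_sub_log {n : ℕ} (hn : 1 ≤ n) :
    1 / ((n : ℝ) + 1) ≤ Real.log (n + 1 : ℕ) - Real.log n := by
  have hn0 : (0 : ℝ) < n := by exact_mod_cast hn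
  push_cast
  rw [← Real.log_div (by positivity) hn0.ne']
  refine le_trans (le_of_eq ?_) (Real.one_sub_inv_le_log_of_pos (by positivity))
  field_simp
  ring

theorem tendsto_log_natCast_atTop : Tendsto (fun n : ℕ => Real.log n) atTop atTop :=
  Real.tendsto_log_atTop.comp tendsto_natCast_atTop_atTop

theorem eventually_abs_le_mul_log_of_recurrence {I e : ℕ → ℝ} {κ κ' : ℝ} (hκ : κ ≤ κ')
    (hκ'0 : 0 ≤ κ') (he : Tendsto e atTop (𝓝 0))
    (hrec : ∀ᶠ n in atTop, I (n + 1) - I n = (κ * I n / Real.log n + e n) / (n + 1))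
    {K : ℝ} (hK : ∀ᶠ n : ℕ in atTop, |I n| ≤ K * Real.log n) {ε : ℝ} (hε : 0 < ε) :
    ∀ᶠ n : ℕ in atTop, |I n| ≤ (κ' * K + ε) * Real.log n := by
  have hlog := tendsto_log_natCast_atTop
  have hsucc : Tendsto (fun n : ℕ => (n : ℝ) + 1) atTop atTop :=
    tendsto_atTop_add_const_right _ _ tendsto_natCast_atTop_atTop
  have hev := hrec.and (hK.and ((hlog.eventually_ge_atTop 1).and
    ((hsucc.eventually_ge_atTop |κ|).and
    ((he.eventually (Metric.ball_mem_nhds 0 (half_pos hε))).and (eventually_ge_atTop 1)))))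
  obtain ⟨N, hN⟩ := eventually_atTop.1 hev
  have hK0 : 0 ≤ K := by
    obtain ⟨_, h2, h3, _⟩ := hN N le_rfl
    by_contra! h
    nlinarith [abs_nonneg (I N)]
  have hind : ∀ n ≥ N, |I n| ≤ (κ' * K + ε / 2) * Real.log n + |I N| := by
    intro n hn
    induction n, hn using Nat.le_induction with
    | base =>
      have := (hN N le_rfl).2.2.1
      have : 0 ≤ (κ' * K + ε / 2) * Real.log N := by positivity
      linarith
    | succ n hn ih =>
      obtain ⟨h1, h2, h3, h4, h5, h6⟩ := hN n hn
      rw [Real.dist_eq, sub_zero] at h5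
      have hn1 : (0 : ℝ) < (n : ℝ) + 1 := by positivity
      have hl : 0 < Real.log n := by linarith
      set q := κ / (((n : ℝ) + 1) * Real.log n) with hq
      have hq1 : |q| ≤ 1 := by
        rw [hq, abs_div, abs_of_pos (by positivity : 0 < ((n : ℝ) + 1) * Real.log n),
          div_le_one (by positivity)]
        nlinarith
      have hq2 : |1 + q| ≤ 1 + κ' / (((n : ℝ) + 1) * Real.log n) := by
        rw [abs_of_nonneg (by linarith [(abs_le.1 hq1).1])]
        have : q ≤ κ' / (((n : ℝ) + 1) * Real.log n) := by
          rw [hq]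
          gcongr
        linarith
      have heq : I (n + 1) = (1 + q) * I n + e n / (n + 1) := by
        have : I (n + 1) = I n + (κ * I n / Real.log n + e n) / (n + 1) := by linarith
        rw [this, hq]
        field_simp
        ring
      have h7 : κ' / (((n : ℝ) + 1) * Real.log n) * |I n| ≤ κ' * K / (n + 1) := by
        rw [div_mul_eq_mul_div, div_le_div_iff₀ (by positivity) hn1]
        nlinarith [mul_le_mul_of_nonneg_left h2 hκ'0]
      have h8 : |e n / (n + 1)| ≤ (ε / 2) / (n + 1) := by
        rw [abs_div, abs_of_pos hn1]
        gcongr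
      have h9 := inv_succ_le_log_succ_sub_log h6
      calc |I (n + 1)| ≤ |1 + q| * |I n| + |e n / (n + 1)| := by
            rw [heq, ← abs_mul]
            exact abs_add_le _ _
        _ ≤ (1 + κ' / (((n : ℝ) + 1) * Real.log n)) * |I n| + (ε / 2) / (n + 1) := by gcongr
        _ ≤ |I n| + (κ' * K + ε / 2) * (1 / (n + 1)) := by
            have : (κ' * K + ε / 2) * (1 / ((n : ℝ) + 1)) =
              κ' * K / (n + 1) + (ε / 2) / (n + 1) := by ring
            rw [this]
            linarith
        _ ≤ |I n| + (κ' * K + ε / 2) * (Real.log (n + 1 : ℕ) - Real.log n) := by gcongr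
        _ ≤ _ := by linarith
  filter_upwards [eventually_ge_atTop N, hlog.eventually_ge_atTop (|I N| / (ε / 2))] with n hn hn'
  have h1 := hind n hn
  rw [div_le_iff₀ (by positivity)] at hn'
  linarith

theorem tendsto_div_log_of_recurrence {I e : ℕ → ℝ} {κ : ℝ} (hκ : κ < 1)
    (he : Tendsto e atTop (𝓝 0))
    (hrec : ∀ᶠ n in atTop, I (n + 1) - I n = (κ * I n / Real.log n + e n) / (n + 1))
    (hI : ∀ᶠ n : ℕ in atTop, |I n| ≤ Real.log n) :
    Tendsto (fun n : ℕ => I n / Real.log n) atTop (𝓝 0) := by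
  obtain ⟨κ', hκκ', hκ'0, hκ'1⟩ : ∃ κ', κ ≤ κ' ∧ 0 ≤ κ' ∧ κ' < 1 :=
    ⟨max κ 0, le_max_left _ _, le_max_right _ _, max_lt hκ one_pos⟩
  have hiter : ∀ ε > 0, ∀ j : ℕ,
      ∀ᶠ n : ℕ in atTop, |I n| ≤ (κ' ^ j + ε / (1 - κ')) * Real.log n := by
    intro ε hε j
    have h1 : 0 < 1 - κ' := by linarith
    induction j with
    | zero =>
      filter_upwards [hI, tendsto_log_natCast_atTop.eventually_ge_atTop 0] with n hn hl
      refine hn.trans (le_mul_of_one_le_left hl ?_)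
      have : 0 < ε / (1 - κ') := by positivity
      simpa using this.le
    | succ j ih =>
      have := eventually_abs_le_mul_log_of_recurrence hκκ' hκ'0 he hrec ih hε
      refine this.mono fun n hn => hn.trans (le_of_eq ?_)
      congr 1
      field_simp
      ring
  rw [Metric.tendsto_nhds]
  intro δ hδ
  obtain ⟨j, hj⟩ := exists_pow_lt_of_lt_one (half_pos hδ) hκ'1
  have h1 : 0 < 1 - κ' := by linarith
  filter_upwards [hiter ((1 - κ') * (δ / 2)) (by positivity) j,
    tendsto_log_natCast_atTop.eventually_gt_atTop 0] with n hn hl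
  rw [Real.dist_eq, sub_zero, abs_div, abs_of_pos hl, div_lt_iff₀ hl]
  refine hn.trans_lt ?_
  rw [mul_div_cancel_left₀ _ h1.ne']
  gcongr
  linarith

/-- If the partial sums `M` and the logarithmic partial sums `L` of a bounded sequence satisfy
`M N * log N = κ * N * L N + o(N log N)` with `κ < 1`, then `M N = o(N)`. -/
theorem tendsto_sum_div_zero_of_sum_mul_log {g : ℕ → ℝ} (hg : ∀ n, |g n| ≤ 1) {κ : ℝ}
    (hκ : κ < 1)
    (h : Tendsto (fun N : ℕ => (∑ n ∈ Finset.Ioc 0 N, g n) / N -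
      κ * (∑ n ∈ Finset.Ioc 0 N, g n / n) / Real.log N) atTop (𝓝 0)) :
    Tendsto (fun N : ℕ => (∑ n ∈ Finset.Ioc 0 N, g n) / N) atTop (𝓝 0) := by
  set M : ℕ → ℝ := fun N => ∑ n ∈ Finset.Ioc 0 N, g n with hM
  set L : ℕ → ℝ := fun N => ∑ n ∈ Finset.Ioc 0 N, g n / n with hL
  have hMs : ∀ n, M (n + 1) = M n + g (n + 1) := fun n =>
    Finset.sum_Ioc_succ_top (Nat.zero_le n) _
  have hLs : ∀ n, L (n + 1) = L n + g (n + 1) / (n + 1 : ℕ) := fun n =>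
    Finset.sum_Ioc_succ_top (Nat.zero_le n) _
  have hMb : ∀ n : ℕ, |M n / n| ≤ 1 := by
    intro n
    rw [abs_div, Nat.abs_cast]
    refine div_le_one_of_le₀ ?_ n.cast_nonneg
    calc |M n| ≤ ∑ k ∈ Finset.Ioc 0 n, |g k| := Finset.abs_sum_le_sum_abs _ _
      _ ≤ ∑ k ∈ Finset.Ioc 0 n, 1 := Finset.sum_le_sum fun k _ => hg k
      _ = n := by simp
  let I : ℕ → ℝ := fun n => L n - M n / n
  let e : ℕ → ℝ := fun n => M n / n - κ * I n / Real.log n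
  have hstep : ∀ n ≥ 1, I (n + 1) - I n = (M n / n) / (n + 1) := by
    intro n hn
    have : (n : ℝ) ≠ 0 := by exact_mod_cast (Nat.one_le_iff_ne_zero.1 hn)
    have : (n : ℝ) + 1 ≠ 0 := by positivity
    simp only [I, hLs, hMs]
    push_cast
    field_simp
    ring
  have hIb : ∀ n ≥ 1, |I n| ≤ Real.log n := by
    intro n hn
    induction n, hn using Nat.le_induction with
    | base => simp [I, L, M]
    | succ n hn ih =>
      have h1 : I (n + 1) = I n + (M n / n) / (n + 1) := by linarith [hstep n hn]
      have h2 : |(M n / n) / ((n : ℝ) + 1)| ≤ 1 / ((n : ℝ) + 1) := by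
        have hn1 : (0 : ℝ) < (n : ℝ) + 1 := by positivity
        rw [abs_div, abs_of_pos hn1]
        gcongr
        exact hMb n
      have h3 := abs_add_le (I n) ((M n / n) / ((n : ℝ) + 1))
      rw [h1]
      linarith [inv_succ_le_log_succ_sub_log hn]
  have hlog := tendsto_log_natCast_atTop
  have he : Tendsto e atTop (𝓝 0) := by
    have h1 : Tendsto (fun n : ℕ => κ * (M n / n) / Real.log n) atTop (𝓝 0) := by
      refine squeeze_zero_norm' (a := fun n : ℕ => |κ| * (Real.log n)⁻¹) ?_ ?_
      · filter_upwards [hlog.eventually_gt_atTop 0] with n hn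
        rw [norm_div, norm_mul, Real.norm_eq_abs, Real.norm_eq_abs, Real.norm_of_nonneg hn.le,
          div_eq_mul_inv]
        gcongr
        exact mul_le_of_le_one_right (abs_nonneg _) (hMb n)
      · simpa using (tendsto_inv_atTop_zero.comp hlog).const_mul |κ|
    have h2 := h.add h1
    rw [add_zero] at h2
    refine h2.congr fun n => ?_
    simp only [e, I]
    ring
  have hrec : ∀ᶠ n in atTop, I (n + 1) - I n = (κ * I n / Real.log n + e n) / (n + 1) := by
    filter_upwards [eventually_ge_atTop 1] with n hn
    rw [hstep n hn]
    simp only [e]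
    ring
  have hfin := tendsto_div_log_of_recurrence hκ he hrec
    ((eventually_ge_atTop 1).mono fun n hn => hIb n hn)
  have := (hfin.const_mul κ).add he
  rw [mul_zero, zero_add] at this
  refine this.congr fun n => ?_
  simp only [e]
  ring

end Recurrence

section PrimeDensity

theorem primeCount_natCast {S : Set ℕ} (hS : ∀ p ∈ S, p.Prime) (N : ℕ) :
    (primeCount S N : ℝ) = ∑ p ∈ Finset.Ioc 0 N with p.Prime, S.indicator 1 p := by
  classical
  have h : {p ∈ S | (p : ℝ) ≤ N} =
      (({p ∈ Finset.Ioc 0 N | p.Prime} : Finset ℕ).filter (· ∈ S) : Finset ℕ) := by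
    ext p
    simp only [Set.mem_ofPred_eq, Finset.coe_filter, Finset.mem_filter, Finset.mem_Ioc,
      Nat.cast_le]
    exact ⟨fun ⟨h1, h2⟩ => ⟨⟨⟨(hS p h1).pos, h2⟩, hS p h1⟩, h1⟩, fun h => ⟨h.2, h.1.1.2⟩⟩
  rw [primeCount, h, Set.ncard_coe_finset, Finset.card_filter]
  push_cast
  exact Finset.sum_congr rfl fun p _ => by simp [Set.indicator_apply]

theorem primeCount_setOf_prime (N : ℕ) :
    primeCount {p | p.Prime} N = N.primeCounting := by
  have h := primeCount_natCast (S := {p | p.Prime}) (fun p hp => hp) N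
  rw [← @Nat.cast_inj ℝ, h, Nat.primeCounting, Nat.primeCounting', Nat.count_eq_card_filter_range,
    Finset.card_eq_sum_ones, Nat.cast_sum, Nat.cast_one]
  refine Finset.sum_congr_of_eq_on_inter ?_ ?_ ?_
  all_goals
    intro p
    simp +contextual [Nat.Prime.pos]

theorem primeCounting_mul_log_div_tendsto :
    Tendsto (fun N : ℕ => N.primeCounting * Real.log N / N) atTop (𝓝 1) := by
  have h := (tendsto_primeCounting_mul_log_sub_theta_div.add tendsto_theta_div).comp
    tendsto_natCast_atTop_atTop
  rw [zero_add] at h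
  refine h.congr fun N => ?_
  simp only [Function.comp, Nat.floor_natCast]
  ring

theorem tendsto_sum_indicator_log_div {S : Set ℕ} (hS : ∀ p ∈ S, p.Prime) {d : ℝ}
    (hd : Tendsto (fun x : ℝ => (primeCount S x : ℝ) / (primeCount {p | p.Prime} x : ℝ))
      atTop (𝓝 d)) :
    Tendsto (fun N : ℕ => (∑ p ∈ Finset.Ioc 0 N with p.Prime, S.indicator 1 p * Real.log p) / N)
      atTop (𝓝 d) := by
  have h1 := (hd.comp tendsto_natCast_atTop_atTop).mul primeCounting_mul_log_div_tendsto
  rw [mul_one] at h1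
  have h2 := tendsto_primeCounting_mul_log_sub_theta_div.comp tendsto_natCast_atTop_atTop
  have h3 : Tendsto (fun N : ℕ => (primeCount S N * Real.log N -
      ∑ p ∈ Finset.Ioc 0 N with p.Prime, S.indicator 1 p * Real.log p) / N) atTop (𝓝 0) := by
    refine squeeze_zero (fun N => ?_) (fun N => ?_) h2
    · refine div_nonneg (sub_nonneg.2 ?_) N.cast_nonneg
      rw [primeCount_natCast hS, Finset.sum_mul]
      refine Finset.sum_le_sum fun p hp => ?_
      simp only [Finset.mem_filter, Finset.mem_Ioc] at hp
      refine mul_le_mul_of_nonneg_left ?_ (Set.indicator_nonneg (fun _ _ => zero_le_one) _)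
      exact Real.log_le_log (by exact_mod_cast hp.1.1) (by exact_mod_cast hp.1.2)
    · simp only [Function.comp, Nat.floor_natCast]
      refine div_le_div_of_nonneg_right ?_ N.cast_nonneg
      rw [← primeCount_setOf_prime, primeCount_natCast hS,
        primeCount_natCast (S := {p | p.Prime}) (fun p hp => hp), Finset.sum_mul, Finset.sum_mul,
        Chebyshev.theta,
        Nat.floor_natCast, ← Finset.sum_sub_distrib, ← Finset.sum_sub_distrib]
      refine Finset.sum_le_sum fun p hp => ?_
      simp only [Finset.mem_filter, Finset.mem_Ioc] at hp
      have h4 : Real.log p ≤ Real.log N :=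
        Real.log_le_log (by exact_mod_cast hp.1.1) (by exact_mod_cast hp.1.2)
      by_cases h5 : p ∈ S <;> simp [h5, hp.2, h4]
  have h4 := h1.sub h3
  rw [sub_zero] at h4
  refine h4.congr' ?_
  filter_upwards [eventually_ge_atTop 2] with N hN
  have h5 : (N.primeCounting : ℝ) ≠ 0 := by
    have : 0 < N.primeCounting := by
      refine (show 0 < Nat.primeCounting 2 by decide).trans_le (Nat.monotone_primeCounting hN)
    exact_mod_cast this.ne'
  simp only [Function.comp, primeCount_setOf_prime]
  field_simp
  ring

/-- The prime number theorem for a sign function on the primes whose level sets have densities. -/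
theorem tendsto_sum_sign_log_div {P0 Pp Pm : Set ℕ}
    (hsub0 : ∀ p ∈ P0, p.Prime) (hsubp : ∀ p ∈ Pp, p.Prime) (hsubm : ∀ p ∈ Pm, p.Prime)
    (hd0p : Disjoint P0 Pp) (hd0m : Disjoint P0 Pm) (hdpm : Disjoint Pp Pm)
    (hcover : P0 ∪ Pp ∪ Pm = {p : ℕ | p.Prime}) {d0 dp dm : ℝ}
    (hnd0 : Tendsto (fun x : ℝ => (primeCount P0 x : ℝ) / (primeCount {p | p.Prime} x : ℝ))
      atTop (𝓝 d0))
    (hndp : Tendsto (fun x : ℝ => (primeCount Pp x : ℝ) / (primeCount {p | p.Prime} x : ℝ))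
      atTop (𝓝 dp))
    (hndm : Tendsto (fun x : ℝ => (primeCount Pm x : ℝ) / (primeCount {p | p.Prime} x : ℝ))
      atTop (𝓝 dm)) (hdm : dm ≠ 0) {g : ℕ → ℝ}
    (hg : ∀ p : ℕ, p.Prime → g p = Pp.indicator 1 p - Pm.indicator 1 p) :
    ∃ κ < 1, Tendsto
      (fun N : ℕ => (∑ p ∈ Finset.Ioc 0 N with p.Prime, g p * Real.log p) / N) atTop (𝓝 κ) := by
  have t0 := tendsto_sum_indicator_log_div hsub0 hnd0
  have tp := tendsto_sum_indicator_log_div hsubp hndp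
  have tm := tendsto_sum_indicator_log_div hsubm hndm
  have p0 : 0 ≤ d0 := ge_of_tendsto' hnd0 fun x => by positivity
  have pm : 0 ≤ dm := ge_of_tendsto' hndm fun x => by positivity
  have ht := tendsto_theta_div.comp tendsto_natCast_atTop_atTop
  have hsum : d0 + dp + dm = 1 := by
    refine tendsto_nhds_unique ((t0.add tp).add tm) (ht.congr fun N => ?_)
    simp only [Function.comp, Chebyshev.theta, Nat.floor_natCast]
    rw [← add_div, ← add_div, ← Finset.sum_add_distrib, ← Finset.sum_add_distrib]
    congr 1
    refine Finset.sum_congr rfl fun p hp => ?_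
    simp only [Finset.mem_filter] at hp
    have h1 : p ∈ P0 ∪ Pp ∪ Pm := hcover ▸ hp.2
    rw [← add_mul, ← add_mul]
    rcases h1 with (h1 | h1) | h1
    · simp [h1, Set.disjoint_left.1 hd0p h1, Set.disjoint_left.1 hd0m h1]
    · simp [h1, Set.disjoint_right.1 hd0p h1, Set.disjoint_left.1 hdpm h1]
    · simp [h1, Set.disjoint_right.1 hd0m h1, Set.disjoint_right.1 hdpm h1]
  have pm' : 0 < dm := lt_of_le_of_ne pm hdm.symm
  refine ⟨dp - dm, by linarith, (tp.sub tm).congr fun N => ?_⟩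
  rw [← sub_div, ← Finset.sum_sub_distrib]
  congr 1
  refine Finset.sum_congr rfl fun p hp => ?_
  rw [hg p (Finset.mem_filter.1 hp).2]
  ring

end PrimeDensity

section MeanValue

theorem sum_Ioc_sum_divisors (F : ℕ → ℕ → ℝ) (N : ℕ) :
    ∑ n ∈ Finset.Ioc 0 N, ∑ d ∈ n.divisors, F d n =
      ∑ d ∈ Finset.Ioc 0 N, ∑ m ∈ Finset.Ioc 0 (N / d), F d (d * m) := by
  rw [Finset.sum_sigma', Finset.sum_sigma']
  refine Finset.sum_bij' (fun x _ => ⟨x.2, x.1 / x.2⟩) (fun x _ => ⟨x.1 * x.2, x.1⟩) ?_ ?_ ?_ ?_ ?_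
  · rintro ⟨n, d⟩ h
    simp only [Finset.mem_sigma, Finset.mem_Ioc, Nat.mem_divisors] at h ⊢
    obtain ⟨⟨h1, h2⟩, h3, h4⟩ := h
    have hd := Nat.pos_of_dvd_of_pos h3 h1
    exact ⟨⟨hd, (Nat.le_of_dvd h1 h3).trans h2⟩, Nat.div_pos (Nat.le_of_dvd h1 h3) hd,
      Nat.div_le_div_right h2⟩
  · rintro ⟨d, m⟩ h
    simp only [Finset.mem_sigma, Finset.mem_Ioc, Nat.mem_divisors] at h ⊢
    obtain ⟨⟨h1, h2⟩, h3, h4⟩ := h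
    refine ⟨⟨Nat.mul_pos h1 h3, ?_⟩, dvd_mul_right _ _, (Nat.mul_pos h1 h3).ne'⟩
    rw [mul_comm]
    exact (Nat.le_div_iff_mul_le h1).1 h4
  · rintro ⟨n, d⟩ h
    simp only [Finset.mem_sigma, Finset.mem_Ioc, Nat.mem_divisors] at h ⊢
    rw [Nat.mul_div_cancel' h.2.1]
  · rintro ⟨d, m⟩ h
    simp only [Finset.mem_sigma, Finset.mem_Ioc] at h ⊢
    rw [Nat.mul_div_cancel_left _ h.1.1]
  · rintro ⟨n, d⟩ h
    simp only [Finset.mem_sigma, Nat.mem_divisors] at h ⊢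
    rw [Nat.mul_div_cancel' h.2.1]

theorem summable_log_div_sq : Summable fun n : ℕ => Real.log n / (n : ℝ) ^ 2 := by
  have h : Summable fun n : ℕ => 2 * (1 / (n : ℝ) ^ (3 / 2 : ℝ)) :=
    (Real.summable_one_div_nat_rpow.2 (by norm_num)).mul_left 2
  refine Summable.of_nonneg_of_le
    (fun n => div_nonneg (Real.log_natCast_nonneg n) (by positivity)) (fun n => ?_) h
  rcases n.eq_zero_or_pos with rfl | hn
  · simp
  have hn0 : (0 : ℝ) < n := by exact_mod_cast hn
  have h1 := Real.log_natCast_le_rpow_div n (show (0 : ℝ) < 1 / 2 by norm_num)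
  rw [div_le_iff₀ (by positivity)]
  have h2 : (n : ℝ) ^ 2 = (n : ℝ) ^ (3 / 2 : ℝ) * (n : ℝ) ^ (1 / 2 : ℝ) := by
    rw [← Real.rpow_add hn0, ← Real.rpow_natCast]
    norm_num
  rw [h2]
  have : (n : ℝ) ^ (3 / 2 : ℝ) ≠ 0 := by positivity
  field_simp
  linarith

theorem summable_vonMangoldt_nonprime_div :
    Summable fun n : ℕ => (if n.Prime then 0 else ArithmeticFunction.vonMangoldt n) / (n : ℝ) := by
  refine (ArithmeticFunction.vonMangoldt.summable_residueClass_non_primes_div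
    (q := 1) (a := 0)).congr fun n => ?_
  simp [ArithmeticFunction.vonMangoldt.residueClass,
    Subsingleton.elim _ (0 : ZMod 1)]

theorem card_filter_dvd_Ioc (K d : ℕ) :
    ((({m ∈ Finset.Ioc 0 K | d ∣ m} : Finset ℕ).card : ℕ) : ℝ) ≤ K / d := by
  rw [Nat.Ioc_filter_dvd_card_eq_div]
  exact Nat.cast_div_le

theorem exists_abs_sum_mul_log_sub_le {g : ℕ → ℝ} (hg : ∀ n, |g n| ≤ 1)
    (hmul : ∀ m n : ℕ, Nat.Coprime m n → g (m * n) = g m * g n) :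
    ∃ C, ∀ N : ℕ, |∑ n ∈ Finset.Ioc 0 N, g n * Real.log n -
      ∑ p ∈ Finset.Ioc 0 N with p.Prime, g p * Real.log p * ∑ m ∈ Finset.Ioc 0 (N / p), g m|
        ≤ C * N := by
  set B : ℕ → ℝ := fun d => (if d.Prime then 0 else ArithmeticFunction.vonMangoldt d) / (d : ℝ) +
    2 * (Real.log d / (d : ℝ) ^ 2) with hB
  have hBs : Summable B := summable_vonMangoldt_nonprime_div.add (summable_log_div_sq.mul_left 2)
  have hBn : ∀ d, 0 ≤ B d := by
    intro d
    have h1 := ArithmeticFunction.vonMangoldt_nonneg (n := d)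
    have h2 := Real.log_natCast_nonneg d
    simp only [hB]
    split_ifs <;> positivity
  refine ⟨∑' d, B d, fun N => ?_⟩
  have h1 : ∑ n ∈ Finset.Ioc 0 N, g n * Real.log n =
      ∑ d ∈ Finset.Ioc 0 N, ∑ m ∈ Finset.Ioc 0 (N / d),
        ArithmeticFunction.vonMangoldt d * g (d * m) := by
    rw [← sum_Ioc_sum_divisors (fun d n => ArithmeticFunction.vonMangoldt d * g n)]
    refine Finset.sum_congr rfl fun n _ => ?_
    rw [← Finset.sum_mul, ArithmeticFunction.vonMangoldt_sum, mul_comm]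
  rw [h1, Finset.sum_filter, ← Finset.sum_sub_distrib]
  calc _ ≤ ∑ d ∈ Finset.Ioc 0 N, B d * N := by
        refine (Finset.abs_sum_le_sum_abs _ _).trans (Finset.sum_le_sum fun d hd => ?_)
        have hd0 : (0 : ℝ) < d := by exact_mod_cast (Finset.mem_Ioc.1 hd).1
        split_ifs with hp
        · rw [ArithmeticFunction.vonMangoldt_apply_prime hp, Finset.mul_sum,
            ← Finset.sum_sub_distrib]
          have h2 : ∀ m ∈ Finset.Ioc 0 (N / d),
              |Real.log d * g (d * m) - g d * Real.log d * g m| ≤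
                if d ∣ m then 2 * Real.log d else 0 := by
            intro m _
            have hl := Real.log_natCast_nonneg d
            split_ifs with hdm
            · have e : Real.log d * g (d * m) - g d * Real.log d * g m =
                Real.log d * (g (d * m) - g d * g m) := by ring
              have h3 : |g d * g m| ≤ 1 := by
                rw [abs_mul]
                exact mul_le_one₀ (hg d) (abs_nonneg _) (hg m)
              have h4 := abs_sub (g (d * m)) (g d * g m)
              rw [e, abs_mul, abs_of_nonneg hl]
              nlinarith [hg (d * m)]
            · rw [hmul d m ((Nat.Prime.coprime_iff_not_dvd hp).2 hdm)]
              have e : Real.log d * (g d * g m) - g d * Real.log d * g m = 0 := by ring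
              rw [e, abs_zero]
          refine (Finset.abs_sum_le_sum_abs _ _).trans ((Finset.sum_le_sum h2).trans ?_)
          rw [← Finset.sum_filter, Finset.sum_const, nsmul_eq_mul]
          have hl := Real.log_natCast_nonneg d
          calc _ ≤ ((N / d : ℕ) : ℝ) / d * (2 * Real.log d) := by
                gcongr
                exact card_filter_dvd_Ioc _ _
            _ ≤ (N / d : ℝ) / d * (2 * Real.log d) := by
                gcongr
                exact Nat.cast_div_le
            _ = B d * N := by
                simp only [hB, if_pos hp]
                field_simp
                ring
        · rw [sub_zero]
          have hL := ArithmeticFunction.vonMangoldt_nonneg (n := d)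
          have hl := Real.log_natCast_nonneg d
          calc _ ≤ ∑ m ∈ Finset.Ioc 0 (N / d), ArithmeticFunction.vonMangoldt d := by
                refine (Finset.abs_sum_le_sum_abs _ _).trans (Finset.sum_le_sum fun m _ => ?_)
                rw [abs_mul, abs_of_nonneg hL]
                exact mul_le_of_le_one_right hL (hg _)
            _ = ((N / d : ℕ) : ℝ) * ArithmeticFunction.vonMangoldt d := by simp
            _ ≤ (N / d : ℝ) * ArithmeticFunction.vonMangoldt d := by
                gcongr
                exact Nat.cast_div_le
            _ = ArithmeticFunction.vonMangoldt d / d * N := by ring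
            _ ≤ B d * N := by
                gcongr
                simp only [hB, if_neg hp]
                exact le_add_of_nonneg_right (by positivity)
    _ = (∑ d ∈ Finset.Ioc 0 N, B d) * N := by rw [Finset.sum_mul]
    _ ≤ _ := by
        gcongr
        exact hBs.sum_le_tsum _ fun d _ => hBn d

theorem abs_sum_mul_log_sub_sum_mul_log_le {g : ℕ → ℝ} (hg : ∀ n, |g n| ≤ 1) (N : ℕ) :
    |(∑ n ∈ Finset.Ioc 0 N, g n) * Real.log N - ∑ n ∈ Finset.Ioc 0 N, g n * Real.log n| ≤ N := by
  rw [Finset.sum_mul, ← Finset.sum_sub_distrib]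
  have hfac : ∑ n ∈ Finset.Ioc 0 N, Real.log n = Real.log (N.factorial) := by
    induction N with
    | zero => simp
    | succ n ih =>
      rw [Finset.sum_Ioc_succ_top (Nat.zero_le n), ih, Nat.factorial_succ, Nat.cast_mul,
        Real.log_mul (by positivity) (by positivity), add_comm]
  calc _ ≤ ∑ n ∈ Finset.Ioc 0 N, (Real.log N - Real.log n) := by
        refine (Finset.abs_sum_le_sum_abs _ _).trans (Finset.sum_le_sum fun n hn => ?_)
        rw [Finset.mem_Ioc] at hn
        have : Real.log n ≤ Real.log N :=
          Real.log_le_log (by exact_mod_cast hn.1) (by exact_mod_cast hn.2)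
        rw [← mul_sub, abs_mul, abs_of_nonneg (sub_nonneg.2 this)]
        exact mul_le_of_le_one_left (sub_nonneg.2 this) (hg n)
    _ = N * Real.log N - Real.log N.factorial := by simp [hfac]
    _ ≤ N := by
        rcases N.eq_zero_or_pos with rfl | hN
        · simp
        have h := Real.pow_div_factorial_le_exp (N : ℝ) N.cast_nonneg N
        have hN0 : (0 : ℝ) < N := by exact_mod_cast hN
        have h2 := Real.log_le_log (by positivity) h
        rwa [Real.log_exp, Real.log_div (by positivity) (by positivity), Real.log_pow] at h2

theorem sum_prime_mul_sum_eq (g : ℕ → ℝ) (N : ℕ) :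
    ∑ p ∈ Finset.Ioc 0 N with p.Prime, g p * Real.log p * ∑ m ∈ Finset.Ioc 0 (N / p), g m =
      ∑ m ∈ Finset.Ioc 0 N, g m *
        ∑ p ∈ Finset.Ioc 0 (N / m) with p.Prime, g p * Real.log p := by
  simp_rw [Finset.mul_sum]
  rw [Finset.sum_comm' (t' := Finset.Ioc 0 N)
    (s' := fun m => {p ∈ Finset.Ioc 0 (N / m) | p.Prime})]
  · exact Finset.sum_congr rfl fun m _ => Finset.sum_congr rfl fun p _ => mul_comm _ _
  · intro p m
    simp only [Finset.mem_filter, Finset.mem_Ioc]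
    constructor
    · rintro ⟨⟨⟨h1, h2⟩, h3⟩, h4, h5⟩
      rw [Nat.le_div_iff_mul_le h1] at h5
      rw [Nat.le_div_iff_mul_le h4]
      exact ⟨⟨⟨h1, by rwa [mul_comm]⟩, h3⟩, h4, (Nat.le_mul_of_pos_right m h1).trans h5⟩
    · rintro ⟨⟨⟨h1, h2⟩, h3⟩, h4, h5⟩
      rw [Nat.le_div_iff_mul_le h4] at h2
      rw [Nat.le_div_iff_mul_le h1]
      exact ⟨⟨⟨h1, (Nat.le_mul_of_pos_right p h4).trans h2⟩, h3⟩, h4, by rwa [mul_comm]⟩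

theorem exists_abs_sub_mul_le_of_tendsto_div {Θ : ℕ → ℝ} {κ : ℝ}
    (h : Tendsto (fun N : ℕ => Θ N / N) atTop (𝓝 κ)) {ε : ℝ} (hε : 0 < ε) :
    ∃ C, ∀ N m : ℕ, |Θ (N / m) - κ * (N / m)| ≤ ε * (N / m) + C := by
  obtain ⟨K, hK⟩ := eventually_atTop.1 (h.eventually (Metric.ball_mem_nhds κ hε))
  set D := ∑ k ∈ Finset.range (K + 1), |Θ k - κ * k| with hD
  have hD0 : 0 ≤ D := Finset.sum_nonneg fun _ _ => abs_nonneg _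
  have h1 : ∀ k : ℕ, |Θ k - κ * k| ≤ ε * k + D := by
    intro k
    rcases le_or_gt k K with hk | hk
    · have h2 : |Θ k - κ * k| ≤ D := Finset.single_le_sum (f := fun k : ℕ => |Θ k - κ * k|)
        (fun _ _ => abs_nonneg _) (Finset.mem_range.2 (Nat.lt_succ_of_le hk))
      have : 0 ≤ ε * k := by positivity
      linarith
    · have hk0 : (0 : ℝ) < k := by exact_mod_cast (Nat.zero_le K).trans_lt hk
      have h2 := hK k hk.le
      rw [Real.dist_eq] at h2
      have h3 : Θ k - κ * k = (Θ k / k - κ) * k := by field_simp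
      rw [h3, abs_mul, Nat.abs_cast]
      nlinarith
  refine ⟨D + |κ|, fun N m => ?_⟩
  have h2 : ((N / m : ℕ) : ℝ) ≤ N / m := Nat.cast_div_le
  have h3 : (N / m : ℝ) - (N / m : ℕ) ≤ 1 := by
    rw [← Nat.floor_div_eq_div (K := ℝ)]
    linarith [Nat.lt_floor_add_one ((N : ℝ) / m)]
  have h4 : Θ (N / m) - κ * (N / m) =
      (Θ (N / m) - κ * (N / m : ℕ)) + κ * ((N / m : ℕ) - N / m) := by ring
  have h5 : |κ * (((N / m : ℕ) : ℝ) - N / m)| ≤ |κ| := by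
    rw [abs_mul]
    refine mul_le_of_le_one_right (abs_nonneg _) ?_
    rw [abs_le]
    constructor <;> linarith
  rw [h4]
  have h6 : ε * ((N / m : ℕ) : ℝ) ≤ ε * (N / m) := by gcongr
  linarith [abs_add_le (Θ (N / m) - κ * (N / m : ℕ)) (κ * (((N / m : ℕ) : ℝ) - N / m)), h1 (N / m)]

/-- A real multiplicative function bounded by `1` whose mean value over the primes (weighted by
`log p`) is less than `1` has mean value zero. -/
theorem tendsto_sum_div_zero_of_prime_sum {g : ℕ → ℝ} (hg : ∀ n, |g n| ≤ 1)
    (hmul : ∀ m n : ℕ, Nat.Coprime m n → g (m * n) = g m * g n) {κ : ℝ} (hκ : κ < 1)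
    (h : Tendsto (fun N : ℕ => (∑ p ∈ Finset.Ioc 0 N with p.Prime, g p * Real.log p) / N)
      atTop (𝓝 κ)) :
    Tendsto (fun N : ℕ => (∑ n ∈ Finset.Ioc 0 N, g n) / N) atTop (𝓝 0) := by
  refine tendsto_sum_div_zero_of_sum_mul_log hg hκ ?_
  obtain ⟨C₁, hC₁⟩ := exists_abs_sum_mul_log_sub_le hg hmul
  have hbound : ∀ ε > 0, ∃ C, ∀ N : ℕ, |(∑ n ∈ Finset.Ioc 0 N, g n) * Real.log N -
      κ * N * ∑ n ∈ Finset.Ioc 0 N, g n / n| ≤ ε * N * Real.log N + C * N := by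
    intro ε hε
    obtain ⟨C₂, hC₂⟩ := exists_abs_sub_mul_le_of_tendsto_div h hε
    refine ⟨1 + C₁ + (ε + C₂), fun N => ?_⟩
    have h1 := abs_sum_mul_log_sub_sum_mul_log_le hg N
    have h2 := hC₁ N
    rw [sum_prime_mul_sum_eq] at h2
    set Θ : ℕ → ℝ := fun N => ∑ p ∈ Finset.Ioc 0 N with p.Prime, g p * Real.log p with hΘ
    have h3 : |∑ m ∈ Finset.Ioc 0 N, g m * Θ (N / m) - κ * N * ∑ n ∈ Finset.Ioc 0 N, g n / n| ≤
        ε * N * Real.log N + (ε + C₂) * N := by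
      rw [Finset.mul_sum, ← Finset.sum_sub_distrib]
      calc _ ≤ ∑ m ∈ Finset.Ioc 0 N, (ε * N * (m : ℝ)⁻¹ + C₂) := by
            refine (Finset.abs_sum_le_sum_abs _ _).trans (Finset.sum_le_sum fun m _ => ?_)
            have e : g m * Θ (N / m) - κ * N * (g m / m) =
              g m * (Θ (N / m) - κ * (N / m)) := by ring
            rw [e, abs_mul]
            refine (mul_le_of_le_one_left (abs_nonneg _) (hg m)).trans ((hC₂ N m).trans ?_)
            rw [div_eq_mul_inv, mul_assoc]
        _ = ε * N * (harmonic N : ℝ) + C₂ * N := by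
            rw [Finset.sum_add_distrib, ← Finset.mul_sum, harmonic_eq_sum_Icc]
            simp [mul_comm, ← Finset.Icc_add_one_left_eq_Ioc]
        _ ≤ ε * N * (1 + Real.log N) + C₂ * N := by
            gcongr
            exact harmonic_le_one_add_log N
        _ = _ := by ring
    have e : (∑ n ∈ Finset.Ioc 0 N, g n) * Real.log N - κ * N * ∑ n ∈ Finset.Ioc 0 N, g n / n =
      ((∑ n ∈ Finset.Ioc 0 N, g n) * Real.log N - ∑ n ∈ Finset.Ioc 0 N, g n * Real.log n) +
      (∑ n ∈ Finset.Ioc 0 N, g n * Real.log n - ∑ m ∈ Finset.Ioc 0 N, g m * Θ (N / m)) +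
      (∑ m ∈ Finset.Ioc 0 N, g m * Θ (N / m) - κ * N * ∑ n ∈ Finset.Ioc 0 N, g n / n) := by ring
    rw [e]
    refine (abs_add_three _ _ _).trans ?_
    linarith
  rw [Metric.tendsto_nhds]
  intro δ hδ
  obtain ⟨C, hC⟩ := hbound (δ / 2) (half_pos hδ)
  filter_upwards [eventually_gt_atTop 0, tendsto_log_natCast_atTop.eventually_gt_atTop 0,
    tendsto_log_natCast_atTop.eventually_gt_atTop (C / (δ / 2))] with N hN hl hl2
  have hN0 : (0 : ℝ) < N := by exact_mod_cast hN
  rw [div_lt_iff₀ (by positivity)] at hl2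
  have e : (∑ n ∈ Finset.Ioc 0 N, g n) / N - κ * (∑ n ∈ Finset.Ioc 0 N, g n / n) / Real.log N =
      ((∑ n ∈ Finset.Ioc 0 N, g n) * Real.log N - κ * N * ∑ n ∈ Finset.Ioc 0 N, g n / n) /
        (N * Real.log N) := by
    field_simp
  rw [Real.dist_eq, sub_zero, e, abs_div, abs_of_pos (show 0 < N * Real.log N by positivity),
    div_lt_iff₀ (by positivity)]
  refine (hC N).trans_lt ?_
  nlinarith

end MeanValue

section Wintner

theorem RegularSet.summable_one_div {S : Set ℕ} (hS : ∀ p ∈ S, p.Prime) (h : RegularSet S 0) :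
    Summable fun p : S => 1 / ((p : ℕ) : ℝ) := by
  obtain ⟨g, ⟨U, hU, hUsub, hgd⟩, hg⟩ := h
  have hcont : ContinuousAt g 1 :=
    (hgd.differentiableAt (hU.mem_nhds (hUsub (by simp)))).continuousAt
  have hbd : ∀ᶠ z in 𝓝 (1 : ℂ), ‖g z‖ < ‖g 1‖ + 1 :=
    hcont.norm.eventually_lt_const (lt_add_one _)
  have hofReal : Tendsto (fun s : ℝ => (s : ℂ)) (𝓝[>] 1) (𝓝 1) :=
    (Complex.continuous_ofReal.tendsto' 1 1 (by simp)).mono_left nhdsWithin_le_nhds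
  refine summable_of_sum_le (c := ‖g 1‖ + 1) (fun p => by positivity) fun u => ?_
  have hlim : Tendsto (fun s : ℝ => ∑ p ∈ u, ((p : ℕ) : ℝ) ^ (-s)) (𝓝[>] 1)
      (𝓝 (∑ p ∈ u, 1 / ((p : ℕ) : ℝ))) := by
    refine Tendsto.mono_left (tendsto_finsetSum _ fun p _ => ?_) nhdsWithin_le_nhds
    have hp : (0 : ℝ) < ((p : ℕ) : ℝ) := by exact_mod_cast (hS p p.2).pos
    have h1 : ContinuousAt (fun s : ℝ => ((p : ℕ) : ℝ) ^ (-s)) 1 :=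
      (continuousAt_const.rpow continuousAt_neg (Or.inl hp.ne'))
    have h2 := h1.tendsto
    rwa [Real.rpow_neg_one, ← one_div] at h2
  refine le_of_tendsto hlim ?_
  filter_upwards [hofReal.eventually hbd, self_mem_nhdsWithin] with s hs hs1
  have hs1 : 1 < s := hs1
  have hsum : Summable fun p : S => ((p : ℕ) : ℝ) ^ (-s) :=
    (Real.summable_nat_rpow.2 (by linarith)).subtype S
  have h1 := hg s (by simpa using hs1)
  rw [Complex.ofReal_zero, zero_mul, zero_add] at h1
  have h2 : (∑' p : S, ((p : ℕ) : ℂ) ^ (-(s : ℂ))) = ((∑' p : S, ((p : ℕ) : ℝ) ^ (-s) : ℝ) : ℂ) := by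
    rw [Complex.ofReal_tsum]
    refine tsum_congr fun p => ?_
    rw [Complex.ofReal_cpow (Nat.cast_nonneg _)]
    simp
  rw [h2] at h1
  rw [← h1, Complex.norm_real] at hs
  calc _ ≤ ∑' p : S, ((p : ℕ) : ℝ) ^ (-s) := hsum.sum_le_tsum _ fun p _ => by positivity
    _ ≤ _ := (le_abs_self _).trans hs.le

/-- A sufficient condition for absolute summability of a multiplicative function. -/
theorem summable_of_prime_tsum_le {G : ℕ → ℝ} (hG0 : ∀ n, 0 ≤ G n) (hG00 : G 0 = 0)
    (hG1 : G 1 = 1) (hmul : ∀ {m n : ℕ}, Nat.Coprime m n → G (m * n) = G m * G n)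
    (hsum : ∀ {p : ℕ}, p.Prime → Summable fun k : ℕ => G (p ^ k)) {b : ℕ → ℝ}
    (hb0 : ∀ p, 0 ≤ b p) (hb : Summable b)
    (hle : ∀ p : ℕ, p.Prime → ∑' k : ℕ, G (p ^ k) ≤ 1 + b p) : Summable G := by
  refine summable_of_sum_le (c := Real.exp (∑' p, b p)) hG0 fun u => ?_
  obtain ⟨N, hN⟩ : ∃ N, ∀ n ∈ u, n < N :=
    ⟨u.sup id + 1, fun n hn => Nat.lt_succ_of_le (Finset.le_sup (f := id) hn)⟩
  have hs : ∀ {p : ℕ}, p.Prime → Summable fun k : ℕ => ‖G (p ^ k)‖ := fun hp => (hsum hp).norm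
  obtain ⟨-, h2⟩ := EulerProduct.summable_and_hasSum_smoothNumbers_prod_primesBelow_tsum
    hG1 hmul hs N
  have h3 : ∑ n ∈ u, G n ≤ ∏ p ∈ N.primesBelow, ∑' k : ℕ, G (p ^ k) := by
    classical
    have h4 : ∑ n ∈ u, G n = ∑ n ∈ u.subtype (· ∈ N.smoothNumbers), G n := by
      rw [Finset.sum_subtype_eq_sum_filter, Finset.sum_filter]
      refine Finset.sum_congr rfl fun n hn => ?_
      rcases n.eq_zero_or_pos with rfl | hn0
      · simp [hG00]
      · rw [if_pos (Nat.mem_smoothNumbers_of_lt hn0 (hN n hn))]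
    rw [h4]
    exact sum_le_hasSum _ (fun n _ => hG0 n) h2
  refine h3.trans ?_
  calc _ ≤ ∏ p ∈ N.primesBelow, Real.exp (b p) := by
        refine Finset.prod_le_prod (fun p _ => tsum_nonneg fun k => hG0 _) fun p hp => ?_
        refine (hle p (Nat.prime_of_mem_primesBelow hp)).trans ?_
        rw [add_comm]
        exact Real.add_one_le_exp _
    _ = Real.exp (∑ p ∈ N.primesBelow, b p) := (Real.exp_sum _ _).symm
    _ ≤ _ := Real.exp_le_exp.2 (hb.sum_le_tsum _ fun p _ => hb0 p)

/-- Wintner's mean value theorem. -/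
theorem tendsto_sum_mul_zeta_div {h : ArithmeticFunction ℝ}
    (hs : Summable fun n : ℕ => |h n| / n) :
    Tendsto (fun N : ℕ => (∑ n ∈ Finset.Ioc 0 N, (h * ArithmeticFunction.zeta) n) / N) atTop
      (𝓝 (∑' n : ℕ, h n / n)) := by
  have h1 : ∀ N : ℕ, (∑ n ∈ Finset.Ioc 0 N, (h * ArithmeticFunction.zeta) n) / N =
      ∑' n : ℕ, h n * ((N / n : ℕ) : ℝ) / N := by
    intro N
    rw [ArithmeticFunction.sum_Ioc_mul_zeta_eq_sum, Finset.sum_div]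
    refine (tsum_eq_sum fun n hn => ?_).symm
    have : N / n = 0 := by
      rw [Finset.mem_Ioc, not_and_or, not_lt, not_le, Nat.le_zero] at hn
      rcases hn with rfl | hn
      · exact Nat.div_zero N
      · exact Nat.div_eq_of_lt hn
    simp [this]
  simp_rw [h1]
  refine tendsto_tsum_of_dominated_convergence hs (fun n => ?_) (Eventually.of_forall fun N n => ?_)
  · have h2 := (tendsto_nat_floor_mul_div_atTop (R := ℝ) (a := 1 / n) (by positivity)).comp
      tendsto_natCast_atTop_atTop
    have h3 := h2.const_mul (h n)
    rw [mul_one_div] at h3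
    refine h3.congr fun N => ?_
    simp only [Function.comp]
    rw [one_div_mul_eq_div, Nat.floor_div_eq_div, mul_div_assoc]
  · rw [Real.norm_eq_abs, mul_div_assoc, abs_mul, div_eq_mul_inv |h n|]
    gcongr
    rw [abs_of_nonneg (by positivity)]
    rcases N.eq_zero_or_pos with rfl | hN
    · simp
    have hN0 : (0 : ℝ) < N := by exact_mod_cast hN
    rw [div_le_iff₀ hN0, mul_comm, ← div_eq_mul_inv]
    exact Nat.cast_div_le

theorem exists_tendsto_sum_div_of_multiplicative {f : ℕ → ℝ} (hf : ∀ n, f n = 0 ∨ f n = 1)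
    (hf1 : f 1 = 1) (hmul : ∀ m n : ℕ, Nat.Coprime m n → f (m * n) = f m * f n)
    (hs : Summable fun p : ℕ => if p.Prime then (1 - f p) / p else 0) :
    ∃ d, Tendsto (fun N : ℕ => (∑ n ∈ Finset.Ioc 0 N, f n) / N) atTop (𝓝 d) := by
  let F : ArithmeticFunction ℝ := ⟨fun n => if n = 0 then 0 else f n, by simp⟩
  have hF : ∀ n, n ≠ 0 → F n = f n := fun n hn => if_neg hn
  have hFm : F.IsMultiplicative := by
    refine ArithmeticFunction.IsMultiplicative.iff_ne_zero.2 ⟨by rw [hF 1 one_ne_zero, hf1], ?_⟩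
    intro m n hm hn hmn
    rw [hF _ (mul_ne_zero hm hn), hF m hm, hF n hn, hmul m n hmn]
  set h : ArithmeticFunction ℝ := F * (ArithmeticFunction.moebius : ArithmeticFunction ℝ) with hh
  have hhm : h.IsMultiplicative := hFm.mul ArithmeticFunction.isMultiplicative_moebius.intCast
  have hζ : h * ArithmeticFunction.zeta = F := by
    rw [hh, mul_assoc, ArithmeticFunction.coe_moebius_mul_coe_zeta, mul_one]
  have hpow : ∀ {p : ℕ}, p.Prime → ∀ k, h (p ^ (k + 1)) = f (p ^ (k + 1)) - f (p ^ k) := by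
    intro p hp k
    have h1 : ∀ k, ∑ i ∈ Finset.range (k + 1), h (p ^ i) = f (p ^ k) := by
      intro k
      rw [← Nat.sum_divisors_prime_pow hp, ← ArithmeticFunction.coe_mul_zeta_apply, hζ,
        hF _ (pow_ne_zero _ hp.ne_zero)]
    rw [← h1 (k + 1), ← h1 k, Finset.sum_range_succ _ (k + 1)]
    ring
  have hpow1 : ∀ {p : ℕ}, p.Prime → ∀ k, |h (p ^ (k + 1))| ≤ 1 := by
    intro p hp k
    rw [hpow hp]
    rcases hf (p ^ (k + 1)) with h1 | h1 <;> rcases hf (p ^ k) with h2 | h2 <;> norm_num [h1, h2]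
  have hb0 : ∀ p : ℕ, 0 ≤ if p.Prime then (1 - f p) / (p : ℝ) else 0 := by
    intro p
    split_ifs
    · rcases hf p with h1 | h1 <;> simp [h1]
    · rfl
  have hgeo : ∀ {p : ℕ}, p.Prime → Summable fun k : ℕ => (1 / (p : ℝ)) ^ 2 * (1 / (p : ℝ)) ^ k := by
    intro p hp
    refine (summable_geometric_of_lt_one (by positivity) ?_).mul_left _
    rw [div_lt_one (by exact_mod_cast hp.pos)]
    exact_mod_cast hp.one_lt
  have hle : ∀ {p : ℕ}, p.Prime → ∀ k : ℕ, |h (p ^ (k + 2))| / ((p ^ (k + 2) : ℕ) : ℝ) ≤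
      (1 / (p : ℝ)) ^ 2 * (1 / (p : ℝ)) ^ k := by
    intro p hp k
    have e : (1 / (p : ℝ)) ^ 2 * (1 / (p : ℝ)) ^ k = 1 / ((p ^ (k + 2) : ℕ) : ℝ) := by
      push_cast
      rw [← pow_add, one_div_pow, add_comm]
    rw [e]
    gcongr
    exact hpow1 hp _
  have htail : ∀ {p : ℕ}, p.Prime →
      Summable fun k : ℕ => |h (p ^ (k + 2))| / ((p ^ (k + 2) : ℕ) : ℝ) := fun hp =>
    Summable.of_nonneg_of_le (fun k => by positivity) (hle hp) (hgeo hp)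
  have hfull : ∀ {p : ℕ}, p.Prime → Summable fun k : ℕ => |h (p ^ k)| / ((p ^ k : ℕ) : ℝ) :=
    fun {p} hp =>
      (summable_nat_add_iff (f := fun k : ℕ => |h (p ^ k)| / ((p ^ k : ℕ) : ℝ)) 2).1 (htail hp)
  have hhs : Summable fun n : ℕ => |h n| / n := by
    refine summable_of_prime_tsum_le (G := fun n => |h n| / n)
      (b := fun p => (if p.Prime then (1 - f p) / (p : ℝ) else 0) + 2 * (1 / (p : ℝ) ^ 2))
      (fun n => by positivity) (by simp) (by simp [hhm.map_one]) ?_ ?_ ?_ ?_ ?_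
    · intro m n hmn
      rw [hhm.map_mul_of_coprime hmn, abs_mul]
      push_cast
      exact (div_mul_div_comm _ _ _ _).symm
    · exact hfull
    · exact fun p => add_nonneg (hb0 p) (by positivity)
    · exact hs.add ((Real.summable_one_div_nat_pow.2 one_lt_two).mul_left 2)
    · intro p hp
      have hp2 : (2 : ℝ) ≤ p := by exact_mod_cast hp.two_le
      rw [← (hfull hp).sum_add_tsum_nat_add 2, if_pos hp]
      have h1 : ∑' k : ℕ, |h (p ^ (k + 2))| / ((p ^ (k + 2) : ℕ) : ℝ) ≤ 2 * (1 / (p : ℝ) ^ 2) := by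
        refine ((htail hp).tsum_le_tsum (hle hp) (hgeo hp)).trans ?_
        have hlt : 1 / (p : ℝ) < 1 := by
          rw [div_lt_one (by linarith)]
          linarith
        rw [tsum_mul_left, tsum_geometric_of_lt_one (by positivity) hlt, one_div_pow, mul_comm]
        gcongr
        rw [inv_le_comm₀ (by linarith) two_pos]
        have : 1 / (p : ℝ) ≤ 1 / 2 := by gcongr
        norm_num at this ⊢
        linarith
      have h2 : ∑ k ∈ Finset.range 2, |h (p ^ k)| / ((p ^ k : ℕ) : ℝ) = 1 + (1 - f p) / p := by
        have h3 := hpow hp 0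
        rw [zero_add, pow_one, pow_zero, hf1] at h3
        rw [Finset.sum_range_succ, Finset.sum_range_one, pow_zero, pow_one, h3, hhm.map_one]
        rcases hf p with h1 | h1 <;> simp [h1]
      rw [h2]
      linarith
  refine ⟨_, (tendsto_sum_mul_zeta_div hhs).congr fun N => ?_⟩
  rw [hζ]
  congr 1
  exact Finset.sum_congr rfl fun n hn => hF n (Finset.mem_Ioc.1 hn).1.ne'

end Wintner

section Density

theorem tendsto_ncard_div {P : ℕ → Prop} {w : ℕ → ℝ} (h1 : ∀ n, P n → w n = 1)
    (h0 : ∀ n, ¬P n → w n = 0) {d : ℝ}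
    (h : Tendsto (fun N : ℕ => (∑ n ∈ Finset.Ioc 0 N, w n) / N) atTop (𝓝 d)) :
    Tendsto (fun x : ℝ => ({n : ℕ | P n ∧ (n : ℝ) ≤ x}.ncard : ℝ) / x) atTop (𝓝 d) := by
  classical
  have hN : ∀ x : ℝ, 0 ≤ x → ({n : ℕ | P n ∧ (n : ℝ) ≤ x}.ncard : ℝ) =
      w 0 + ∑ n ∈ Finset.Ioc 0 ⌊x⌋₊, w n := by
    intro x hx
    have hset : {n : ℕ | P n ∧ (n : ℝ) ≤ x} = ({n ∈ Finset.Icc 0 ⌊x⌋₊ | P n} : Finset ℕ) := by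
      ext n
      simp [Nat.le_floor_iff hx, and_comm]
    rw [hset, Set.ncard_coe_finset, Finset.card_filter,
      ← Finset.add_sum_Ioc_eq_sum_Icc (Nat.zero_le _)]
    have hw : ∀ n, ((if P n then 1 else 0 : ℕ) : ℝ) = w n := by
      intro n
      split_ifs with hP
      · simp [h1 n hP]
      · simp [h0 n hP]
    push_cast [hw]
    simp [← hw]
  have h2 := (h.comp (tendsto_nat_floor_atTop (α := ℝ))).mul (tendsto_nat_floor_div_atTop (R := ℝ))
  have h3 := (tendsto_inv_atTop_zero.const_mul (w 0)).add h2
  rw [mul_zero, zero_add, mul_one] at h3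
  refine h3.congr' ?_
  filter_upwards [eventually_ge_atTop 1] with x hx
  have hf : (⌊x⌋₊ : ℝ) ≠ 0 := by exact_mod_cast (Nat.floor_pos.2 hx).ne'
  have hx0 : x ≠ 0 := by linarith
  rw [hN x (by linarith)]
  simp only [Function.comp]
  field_simp

end Density

/-- Let `ℙ = ℙ₀ ⊔ ℙ₊ ⊔ ℙ₋` be a partition of the primes into three sets each
having a natural density, such that `ℙ₀` is regular of density 0 and the natural density of
`ℙ₋` is nonzero. Let `ψ : ℕ → ℝ` be multiplicative with values in `{0,1,-1}` whose sign at
each prime matches the partition. Then `{n : ψ(n) ≠ 0}` has a natural density `d`, and both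
`{n : ψ(n) > 0}` and `{n : ψ(n) < 0}` have natural density `d/2`. -/
theorem natural_density_equidistribution_of_regular_partition
    (P0 Pp Pm : Set ℕ)
    (hsub0 : ∀ p ∈ P0, Nat.Prime p) (hsubp : ∀ p ∈ Pp, Nat.Prime p)
    (hsubm : ∀ p ∈ Pm, Nat.Prime p)
    (hd0p : Disjoint P0 Pp) (hd0m : Disjoint P0 Pm) (hdpm : Disjoint Pp Pm)
    (hcover : P0 ∪ Pp ∪ Pm = {p : ℕ | Nat.Prime p})
    (d0 : ℝ) (hnd0 : Tendsto
      (fun x : ℝ => (primeCount P0 x : ℝ) / (primeCount {p | Nat.Prime p} x : ℝ))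
      atTop (𝓝 d0))
    (dp : ℝ) (hndp : Tendsto
      (fun x : ℝ => (primeCount Pp x : ℝ) / (primeCount {p | Nat.Prime p} x : ℝ))
      atTop (𝓝 dp))
    (dm : ℝ) (hndm : Tendsto
      (fun x : ℝ => (primeCount Pm x : ℝ) / (primeCount {p | Nat.Prime p} x : ℝ))
      atTop (𝓝 dm))
    (hreg0 : RegularSet P0 0) (hdm : dm ≠ 0)
    (ψ : ℕ → ℝ) (hψ1 : ψ 1 = 1)
    (hψmul : ∀ m n : ℕ, Nat.Coprime m n → ψ (m * n) = ψ m * ψ n)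
    (hψval : ∀ n : ℕ, ψ n = 0 ∨ ψ n = 1 ∨ ψ n = -1)
    (hψp : ∀ p : ℕ, Nat.Prime p →
      (ψ p = 0 ↔ p ∈ P0) ∧ (ψ p = 1 ↔ p ∈ Pp) ∧ (ψ p = -1 ↔ p ∈ Pm)) :
    ∃ d : ℝ,
      Tendsto (fun x : ℝ => ({n : ℕ | ψ n ≠ 0 ∧ (n : ℝ) ≤ x}.ncard : ℝ) / x)
        atTop (𝓝 d) ∧
      Tendsto (fun x : ℝ => ({n : ℕ | 0 < ψ n ∧ (n : ℝ) ≤ x}.ncard : ℝ) / x)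
        atTop (𝓝 (d / 2)) ∧
      Tendsto (fun x : ℝ => ({n : ℕ | ψ n < 0 ∧ (n : ℝ) ≤ x}.ncard : ℝ) / x)
        atTop (𝓝 (d / 2)) := by
  have habs : ∀ n, |ψ n| ≤ 1 := by
    intro n
    rcases hψval n with h | h | h <;> simp [h]
  obtain ⟨κ, hκ, hprime⟩ := tendsto_sum_sign_log_div hsub0 hsubp hsubm hd0p hd0m hdpm hcover
    hnd0 hndp hndm hdm (g := ψ) (by
      intro p hp
      obtain ⟨h0, h1, h2⟩ := hψp p hp
      rcases hψval p with h | h | h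
      · simp [h, h1.not.1 (by norm_num [h]), h2.not.1 (by norm_num [h])]
      · simp [h, h1.1 h, h2.not.1 (by norm_num [h])]
      · simp [h, h1.not.1 (by norm_num [h]), h2.1 h])
  have hmean := tendsto_sum_div_zero_of_prime_sum habs hψmul hκ hprime
  have hsum : Summable (P0.indicator fun p : ℕ => 1 / (p : ℝ)) :=
    summable_subtype_iff_indicator.1 (hreg0.summable_one_div hsub0)
  obtain ⟨d, hd⟩ := exists_tendsto_sum_div_of_multiplicative (f := fun n => ψ n ^ 2)
    (fun n => by rcases hψval n with h | h | h <;> simp [h]) (by simp [hψ1])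
    (fun m n hmn => by simp only [hψmul m n hmn, mul_pow]) (by
      refine hsum.congr fun p => ?_
      by_cases hp : p.Prime
      · rw [if_pos hp]
        by_cases h : p ∈ P0
        · simp [h, (hψp p hp).1.2 h]
        · rcases hψval p with h' | h' | h'
          · exact absurd ((hψp p hp).1.1 h') h
          · simp [h, h']
          · simp [h, h']
      · rw [if_neg hp, Set.indicator_of_notMem fun h => hp (hsub0 p h)])
  refine ⟨d, tendsto_ncard_div (w := fun n => ψ n ^ 2) ?_ ?_ hd,
    tendsto_ncard_div (w := fun n => (ψ n ^ 2 + ψ n) / 2) ?_ ?_ ?_,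
    tendsto_ncard_div (w := fun n => (ψ n ^ 2 - ψ n) / 2) ?_ ?_ ?_⟩
  case refine_5 =>
    have h := (hd.add hmean).div_const 2
    rw [add_zero] at h
    refine h.congr fun N => ?_
    rw [← Finset.sum_div, Finset.sum_add_distrib]
    ring
  case refine_8 =>
    have h := (hd.sub hmean).div_const 2
    rw [sub_zero] at h
    refine h.congr fun N => ?_
    rw [← Finset.sum_div, Finset.sum_sub_distrib]
    ring
  all_goals
    intro n
    rcases hψval n with h | h | h <;> norm_num [h]
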